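/- Let n ≥ 3 and let C be a real symmetric positive definite n×n matrix with n distinct eigenvalues. There exists an open dense subset 𝒢 of so(n) (the real skew-symmetric n×n matrices) such that for every G ∈ 𝒢 the non-damped Euler–Frahm system with a single torque, I_C(Ω̇(t)) = [C, Ω(t)²] + u(t)·I_C(G) (where I_C(X) = XC + CX), is globally controllable: for every pair of skew-symmetric matrices Ω̃, Ω̂ there exist T ≥ 0, a piecewise constant control u : [0,T] → ℝ, and a piecewise C¹ solution Ω with Ω(0) = Ω̃ and Ω(T) = Ω̂. Moreover, the same conclusion holds under any bound on the control: for every b > 0 the steering can be achieved with |u(t)| ≤ b for all t. -/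

import Mathlib

open Matrix Set

/-- Square real matrices of size `n`. -/
abbrev Mat (n : ℕ) := Matrix (Fin n) (Fin n) ℝ

/-- The inertia operator `I_C(X) = XC + CX` of the multidimensional rigid body. -/
def IC {n : ℕ} (C X : Mat n) : Mat n := X * C + C * X

/-- Matrix commutator `[A, B] = AB - BA`. -/
def mbracket {n : ℕ} (A B : Mat n) : Mat n := A * B - B * A

/-- A matrix is skew-symmetric, i.e. belongs to `so(n)`. -/
def IsSkew {n : ℕ} (X : Mat n) : Prop := Xᵀ = -X

/-- `Steers C ν G Ω₀ Ω₁` : there are a time `T ≥ 0`, piecewise constant controls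
`u j : [0,T] → ℝ` and a piecewise `C¹` curve `Ω : [0,T] → so(n)` with `Ω 0 = Ω₀`,
`Ω T = Ω₁`, solving the controlled damped Euler–Frahm equation
`I_C(Ω̇) = [C, Ω²] − ν I_C(Ω) + Σⱼ uⱼ(t) I_C(Gʲ)` on each subinterval of constancy. -/
def Steers {n m : ℕ} (C : Mat n) (ν : ℝ) (G : Fin m → Mat n) (Ω₀ Ω₁ : Mat n) : Prop :=
  ∃ (T : ℝ) (u : Fin m → ℝ → ℝ) (Ω : ℝ → Mat n) (k : ℕ) (t : ℕ → ℝ),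
    0 ≤ T ∧ t 0 = 0 ∧ t k = T ∧
    (∀ i, i < k → t i < t (i + 1)) ∧
    ContinuousOn Ω (Icc 0 T) ∧
    (∀ s ∈ Icc (0 : ℝ) T, IsSkew (Ω s)) ∧
    Ω 0 = Ω₀ ∧ Ω T = Ω₁ ∧
    (∀ i, i < k → ∀ j : Fin m, ∃ c : ℝ, ∀ s ∈ Ioo (t i) (t (i + 1)), u j s = c) ∧
    (∀ i, i < k → ∀ s ∈ Ioo (t i) (t (i + 1)), ∃ D : Mat n,
      (∀ p q : Fin n, HasDerivAt (fun τ => Ω τ p q) (D p q) s) ∧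
      IC C D = mbracket C ((Ω s) ^ 2) - ν • IC C (Ω s) + ∑ j, u j s • IC C (G j))

/-- Same as `Steers` but the controls are additionally bounded: `|uⱼ(s)| ≤ b` on `[0,T]`. -/
def SteersBounded {n m : ℕ} (C : Mat n) (ν : ℝ) (G : Fin m → Mat n) (b : ℝ)
    (Ω₀ Ω₁ : Mat n) : Prop :=
  ∃ (T : ℝ) (u : Fin m → ℝ → ℝ) (Ω : ℝ → Mat n) (k : ℕ) (t : ℕ → ℝ),
    0 ≤ T ∧ t 0 = 0 ∧ t k = T ∧
    (∀ i, i < k → t i < t (i + 1)) ∧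
    ContinuousOn Ω (Icc 0 T) ∧
    (∀ s ∈ Icc (0 : ℝ) T, IsSkew (Ω s)) ∧
    Ω 0 = Ω₀ ∧ Ω T = Ω₁ ∧
    (∀ j : Fin m, ∀ s ∈ Icc (0 : ℝ) T, |u j s| ≤ b) ∧
    (∀ i, i < k → ∀ j : Fin m, ∃ c : ℝ, ∀ s ∈ Ioo (t i) (t (i + 1)), u j s = c) ∧
    (∀ i, i < k → ∀ s ∈ Ioo (t i) (t (i + 1)), ∃ D : Mat n,
      (∀ p q : Fin n, HasDerivAt (fun τ => Ω τ p q) (D p q) s) ∧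
      IC C D = mbracket C ((Ω s) ^ 2) - ν • IC C (Ω s) + ∑ j, u j s • IC C (G j))

section PartOne
open Filter Topology Metric
open scoped NNReal

variable {E : Type*} [NormedAddCommGroup E] [NormedSpace ℝ E]

/-- Two-sided Gronwall inequality. -/
lemma gron_two {f f' : ℝ → E} {δ K ε T : ℝ}
    (hf : ∀ t ∈ Icc (-T) T, HasDerivWithinAt f (f' t) (Icc (-T) T) t)
    (h0 : ‖f 0‖ ≤ δ) (hb : ∀ t ∈ Icc (-T) T, ‖f' t‖ ≤ K * ‖f t‖ + ε) :
    ∀ t ∈ Icc (-T) T, ‖f t‖ ≤ gronwallBound δ K ε |t| := by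
  have key : ∀ (g g' : ℝ → E), (∀ t ∈ Icc (-T) T, HasDerivWithinAt g (g' t) (Icc (-T) T) t) →
      ‖g 0‖ ≤ δ → (∀ t ∈ Icc (-T) T, ‖g' t‖ ≤ K * ‖g t‖ + ε) →
      ∀ t ∈ Icc 0 T, ‖g t‖ ≤ gronwallBound δ K ε t := by
    intro g g' hg hg0 hgb t ht
    have hT : 0 ≤ T := ht.1.trans ht.2
    have hsub : Icc 0 T ⊆ Icc (-T) T := Icc_subset_Icc (by linarith) le_rfl
    have := norm_le_gronwallBound_of_norm_deriv_right_le (f := g) (f' := g') (a := 0) (b := T)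
      (δ := δ) (K := K) (ε := ε)
      (fun s hs => ((hg s (hsub hs)).continuousWithinAt.mono hsub))
      (fun s hs => by
        have h1 := hg s (hsub ⟨hs.1, hs.2.le⟩)
        refine h1.mono_of_mem_nhdsWithin ?_
        have : Icc s T ∈ 𝓝[≥] s := Icc_mem_nhdsGE hs.2
        exact mem_of_superset this (Icc_subset_Icc (by linarith [hs.1]) le_rfl))
      hg0 (fun s hs => hgb s (hsub ⟨hs.1, hs.2.le⟩)) t ht
    simpa using this
  intro t ht
  rcases le_total 0 t with h | h
  · rw [abs_of_nonneg h]; exact key f f' hf h0 hb t ⟨h, ht.2⟩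
  · rw [abs_of_nonpos h]
    have := key (fun s => f (-s)) (fun s => - f' (-s)) (fun s hs => by
        have h1 := hf (-s) ⟨by linarith [hs.2], by linarith [hs.1]⟩
        have h2 : HasDerivWithinAt (fun s : ℝ => -s) (-1) (Icc (-T) T) s :=
          (hasDerivAt_neg s).hasDerivWithinAt
        have h3 := h1.scomp s h2 (fun r hr => ⟨by linarith [hr.2], by linarith [hr.1]⟩)
        simpa [Function.comp_def] using h3) (by simpa using h0)
        (fun s hs => by
          simpa using hb (-s) ⟨by linarith [hs.2], by linarith [hs.1]⟩) (-t)
        ⟨by linarith, by linarith [ht.1]⟩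
    simpa using this

/-- Quadratic vector field. -/
noncomputable def QF (β : E →L[ℝ] E →L[ℝ] E) (g x : E) : E := β x x + g

lemma QF_contDiff (β : E →L[ℝ] E →L[ℝ] E) (g : E) {k : WithTop ℕ∞} : ContDiff ℝ k (QF β g) := by
  unfold QF; fun_prop

/-- Two bounded solutions of a quadratic ODE stay close. -/
lemma QF_dist (β : E →L[ℝ] E →L[ℝ] E) (g : E) {γ η : ℝ → E} {T R : ℝ}
    (hγ : ∀ t ∈ Icc (-T) T, HasDerivWithinAt γ (QF β g (γ t)) (Icc (-T) T) t)
    (hη : ∀ t ∈ Icc (-T) T, HasDerivWithinAt η (QF β g (η t)) (Icc (-T) T) t)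
    (hγR : ∀ t ∈ Icc (-T) T, ‖γ t‖ ≤ R) (hηR : ∀ t ∈ Icc (-T) T, ‖η t‖ ≤ R) :
    ∀ t ∈ Icc (-T) T, ‖γ t - η t‖ ≤ ‖γ 0 - η 0‖ * Real.exp (2 * ‖β‖ * R * |t|) := by
  intro t ht
  have := gron_two (f := fun t => γ t - η t) (f' := fun t => QF β g (γ t) - QF β g (η t))
    (K := 2 * ‖β‖ * R) (ε := 0) (T := T) (δ := ‖γ 0 - η 0‖)
    (fun t ht => (hγ t ht).sub (hη t ht)) le_rfl (fun t ht => by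
      have e : QF β g (γ t) - QF β g (η t) = β (γ t) (γ t - η t) + β (γ t - η t) (η t) := by
        simp [QF]
      have h1 := β.le_opNorm₂ (γ t) (γ t - η t)
      have h2 := β.le_opNorm₂ (γ t - η t) (η t)
      have h3 := hγR t ht
      have h4 := hηR t ht
      rw [e]
      calc _ ≤ _ := norm_add_le _ _
        _ ≤ ‖β‖ * ‖γ t‖ * ‖γ t - η t‖ + ‖β‖ * ‖γ t - η t‖ * ‖η t‖ := add_le_add h1 h2
        _ ≤ ‖β‖ * R * ‖γ t - η t‖ + ‖β‖ * ‖γ t - η t‖ * R := by gcongr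
        _ = _ := by ring) t ht
  rwa [gronwallBound_ε0] at this

/-- A priori bounds. -/
def Apriori (β : E →L[ℝ] E →L[ℝ] E) (g : E) : Prop :=
  ∀ r T : ℝ, ∃ R, ∀ χ : ℝ → ℝ, (∀ y, 0 ≤ χ y ∧ χ y ≤ 1) → ∀ γ : ℝ → E, ‖γ 0‖ ≤ r →
    (∀ t ∈ Icc (-T) T, HasDerivWithinAt γ (χ t • QF β g (γ t)) (Icc (-T) T) t) →
    ∀ t ∈ Icc (-T) T, ‖γ t‖ ≤ R

variable [FiniteDimensional ℝ E]

lemma exists_sol (β : E →L[ℝ] E →L[ℝ] E) (g : E) (hA : Apriori β g) (x : E) (T : ℝ) (hT : 0 ≤ T) :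
    ∃ γ : ℝ → E, γ 0 = x ∧
      ∀ t ∈ Icc (-T) T, HasDerivWithinAt γ (QF β g (γ t)) (Icc (-T) T) t := by
  have : CompleteSpace E := FiniteDimensional.complete ℝ E
  obtain ⟨R, hR⟩ := hA ‖x‖ T
  let χ : ContDiffBump (0 : E) := ⟨|R| + 1, |R| + 2, by positivity, by linarith⟩
  let v : E → E := fun y => χ y • QF β g y
  have hv : ContDiff ℝ 1 v := χ.contDiff.smul (QF_contDiff β g)
  have hc : HasCompactSupport v := χ.hasCompactSupport.smul_right
  obtain ⟨K, hK⟩ := ContDiff.lipschitzWith_of_hasCompactSupport hc hv (by simp)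
  obtain ⟨L, hL⟩ := hc.exists_bound_of_continuous hv.continuous
  have hL0 : 0 ≤ L := (norm_nonneg _).trans (hL 0)
  have hPL : IsPicardLindelof (fun _ => v) (tmin := -T) (tmax := T) ⟨0, by constructor <;> linarith⟩
      x (L * T).toNNReal 0 L.toNNReal K := by
    apply IsPicardLindelof.of_time_independent
    · intro y _; simpa [Real.coe_toNNReal _ hL0] using hL y
    · exact hK.lipschitzOnWith
    · simp [Real.coe_toNNReal _ hL0, Real.coe_toNNReal _ (mul_nonneg hL0 hT)]
  obtain ⟨γ, hγ0, hγ⟩ := hPL.exists_eq_forall_mem_Icc_hasDerivWithinAt₀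
  have hγ0 : γ 0 = x := hγ0
  have hb := hR (fun s => χ (γ s)) (fun y => ⟨χ.nonneg, χ.le_one⟩) γ (by rw [hγ0]) hγ
  refine ⟨γ, hγ0, fun t ht => ?_⟩
  have h1 := hγ t ht
  have h2 : χ (γ t) = 1 := by
    apply χ.one_of_mem_closedBall
    simp only [mem_closedBall, dist_zero_right]
    show _ ≤ |R| + 1
    linarith [hb t ht, le_abs_self R]
  simpa [v, h2] using h1

/-- Globally defined flow. -/
lemma exists_flow (β : E →L[ℝ] E →L[ℝ] E) (g : E) (hA : Apriori β g) :
    ∃ φ : ℝ → E → E, (∀ x, φ 0 x = x) ∧ (∀ t x, HasDerivAt (fun s => φ s x) (QF β g (φ t x)) t) := by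
  choose! γ h0 hγ using fun (x : E) (T : ℝ) => exists_sol β g hA x T
  have agree : ∀ x T T' t, 0 ≤ T → T ≤ T' → t ∈ Icc (-T) T → γ x T t = γ x T' t := by
    intro x T T' t hT hTT' ht
    have hs : Icc (-T) T ⊆ Icc (-T') T' := Icc_subset_Icc (by linarith) hTT'
    have k1 := hγ x T hT
    have k2 : ∀ t ∈ Icc (-T) T, HasDerivWithinAt (γ x T') (QF β g (γ x T' t)) (Icc (-T) T) t :=
      fun t ht => (hγ x T' (hT.trans hTT') t (hs ht)).mono hs
    obtain ⟨R, hR⟩ := hA ‖x‖ T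
    have b1 := hR (fun _ => 1) (by simp) (γ x T) (by rw [h0 x T hT]) (by simpa using k1)
    have b2 := hR (fun _ => 1) (by simp) (γ x T') (by rw [h0 x T' (hT.trans hTT')]) (by simpa using k2)
    have := QF_dist β g k1 k2 b1 b2 t ht
    rw [h0 x T hT, h0 x T' (hT.trans hTT')] at this
    simp only [sub_self, norm_zero, zero_mul, norm_le_zero_iff] at this
    exact sub_eq_zero.mp this
  refine ⟨fun t x => γ x (|t| + 1) t, fun x => h0 x _ (by positivity), fun t x => ?_⟩
  have hin : t ∈ Ioo (-(|t| + 2)) (|t| + 2) := by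
    constructor
    · linarith [neg_abs_le t]
    · linarith [le_abs_self t]
  have h1 := (hγ x (|t| + 2) (by positivity) t (Ioo_subset_Icc_self hin)).hasDerivAt
    (Icc_mem_nhds hin.1 hin.2)
  have e : ∀ s, |s| + 1 ≤ |t| + 2 → γ x (|s| + 1) s = γ x (|t| + 2) s := fun s hs =>
    agree x _ _ s (by positivity) hs ⟨by linarith [neg_abs_le s], by linarith [le_abs_self s]⟩
  have h2 := h1.congr_of_eventuallyEq (f₁ := fun s => γ x (|s| + 1) s) (by
    have : ∀ᶠ s in 𝓝 t, |s| < |t| + 1 := by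
      have : Continuous fun s : ℝ => |s| := continuous_abs
      exact this.continuousAt.eventually (gt_mem_nhds (by linarith))
    filter_upwards [this] with s hs
    exact e s (by linarith))
  rw [← e t (by linarith)] at h2
  exact h2

end PartOne

section PartTwo
set_option linter.unusedSectionVars false
open Filter Topology Metric
open scoped NNReal

variable {E : Type*} [NormedAddCommGroup E] [NormedSpace ℝ E]

/-- `φ` is the flow of a quadratic field. -/
structure IsFlow (β : E →L[ℝ] E →L[ℝ] E) (g : E) (φ : ℝ → E → E) : Prop where
  zero : ∀ x, φ 0 x = x
  deriv : ∀ t x, HasDerivAt (fun s => φ s x) (QF β g (φ t x)) t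

variable {β : E →L[ℝ] E →L[ℝ] E} {g : E} {φ : ℝ → E → E}

lemma curve_bdd (hA : Apriori β g) (r T : ℝ) :
    ∃ R, 0 ≤ R ∧ ∀ γ : ℝ → E, (∀ t, HasDerivAt γ (QF β g (γ t)) t) → ‖γ 0‖ ≤ r →
      ∀ t ∈ Icc (-T) T, ‖γ t‖ ≤ R := by
  obtain ⟨R, hR⟩ := hA r T
  refine ⟨|R|, abs_nonneg _, fun γ hγ h0 t ht => ?_⟩
  exact (hR (fun _ => 1) (by simp) γ h0 (fun s _ => by
    simpa using (hγ s).hasDerivWithinAt) t ht).trans (le_abs_self R)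

lemma IsFlow.bdd (h : IsFlow β g φ) (hA : Apriori β g) (r T : ℝ) :
    ∃ R, 0 ≤ R ∧ ∀ x, ‖x‖ ≤ r → ∀ t ∈ Icc (-T) T, ‖φ t x‖ ≤ R := by
  obtain ⟨R, hR0, hR⟩ := curve_bdd hA r T
  exact ⟨R, hR0, fun x hx t ht => hR (fun s => φ s x) (fun s => h.deriv s x) (by rwa [h.zero]) t ht⟩

lemma IsFlow.uniq (h : IsFlow β g φ) (hA : Apriori β g) {γ : ℝ → E}
    (hγ : ∀ t, HasDerivAt γ (QF β g (γ t)) t) (t : ℝ) : γ t = φ t (γ 0) := by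
  obtain ⟨R, hR0, hR⟩ := curve_bdd hA ‖γ 0‖ |t|
  have ht : t ∈ Icc (-|t|) |t| := ⟨neg_abs_le t, le_abs_self t⟩
  have := QF_dist β g (γ := γ) (η := fun s => φ s (γ 0)) (T := |t|) (R := R)
    (fun s _ => (hγ s).hasDerivWithinAt) (fun s _ => (h.deriv s _).hasDerivWithinAt)
    (hR γ hγ le_rfl) (hR _ (fun s => h.deriv s _) (by rw [h.zero])) t ht
  simp only [h.zero, sub_self, norm_zero, zero_mul, norm_le_zero_iff] at this
  exact sub_eq_zero.mp this

lemma IsFlow.add (h : IsFlow β g φ) (hA : Apriori β g) (s t : ℝ) (x : E) :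
    φ (s + t) x = φ s (φ t x) := by
  have := h.uniq hA (γ := fun s => φ (s + t) x) (fun s => by
    simpa using (h.deriv (s + t) x).comp_add_const s t) s
  simpa using this

lemma IsFlow.neg_left (h : IsFlow β g φ) (hA : Apriori β g) (t : ℝ) (x : E) :
    φ (-t) (φ t x) = x := by
  rw [← h.add hA]; simp [h.zero]

lemma IsFlow.neg_right (h : IsFlow β g φ) (hA : Apriori β g) (t : ℝ) (x : E) :
    φ t (φ (-t) x) = x := by
  rw [← h.add hA]; simp [h.zero]

lemma IsFlow.lip (h : IsFlow β g φ) (hA : Apriori β g) (r T : ℝ) :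
    ∃ K : ℝ≥0, ∀ t ∈ Icc (-T) T, LipschitzOnWith K (φ t) (closedBall 0 r) := by
  obtain ⟨R, hR0, hR⟩ := h.bdd hA r T
  refine ⟨(Real.exp (2 * ‖β‖ * R * |T|)).toNNReal, fun t ht => ?_⟩
  apply LipschitzOnWith.of_dist_le_mul
  intro x hx y hy
  have hx' : ‖x‖ ≤ r := by simpa using hx
  have hy' : ‖y‖ ≤ r := by simpa using hy
  have := QF_dist β g (γ := fun s => φ s x) (η := fun s => φ s y) (T := T) (R := R)
    (fun s _ => (h.deriv s _).hasDerivWithinAt) (fun s _ => (h.deriv s _).hasDerivWithinAt)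
    (hR x hx') (hR y hy') t ht
  simp only [h.zero] at this
  rw [dist_eq_norm, dist_eq_norm, Real.coe_toNNReal _ (Real.exp_pos _).le]
  refine this.trans ?_
  rw [mul_comm]
  have : |t| ≤ |T| := (abs_le.mpr ht).trans (le_abs_self T)
  gcongr

lemma IsFlow.cont (h : IsFlow β g φ) (hA : Apriori β g) :
    Continuous (fun p : ℝ × E => φ p.1 p.2) := by
  rw [continuous_iff_continuousAt]
  rintro ⟨t, x⟩
  obtain ⟨K, hK⟩ := h.lip hA (‖x‖ + 1) (|t| + 1)
  have := continuousOn_prod_of_continuousOn_lipschitzOnWith' (fun p : ℝ × E => φ p.1 p.2)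
    (s := Icc (-(|t| + 1)) (|t| + 1)) (t := closedBall 0 (‖x‖ + 1)) K hK
    (fun y _ => (continuous_iff_continuousAt.mpr
      (fun s => (h.deriv s y).continuousAt)).continuousOn)
  apply this.continuousAt
  apply prod_mem_nhds
  · exact Icc_mem_nhds (by linarith [neg_abs_le t]) (by linarith [le_abs_self t])
  · apply mem_of_superset (isOpen_ball.mem_nhds (x := x) (s := ball 0 (‖x‖ + 1)) (by simp))
    exact ball_subset_closedBall

/-- Derivative of the quadratic field. -/
noncomputable def DQ (β : E →L[ℝ] E →L[ℝ] E) (x : E) : E →L[ℝ] E := β x + β.flip x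

lemma DQ_apply (β : E →L[ℝ] E →L[ℝ] E) (x v : E) : DQ β x v = β x v + β v x := rfl

/-- Tangent bilinear map. -/
noncomputable def TB (β : E →L[ℝ] E →L[ℝ] E) : (E × E) →L[ℝ] (E × E) →L[ℝ] (E × E) :=
  LinearMap.mkContinuous₂ (LinearMap.mk₂ ℝ (fun p q : E × E => (β p.1 q.1, β p.1 q.2 + β p.2 q.1))
    (by intros; ext <;> simp; abel) (by intros; ext <;> simp)
    (by intros; ext <;> simp; abel) (by intros; ext <;> simp)) (2 * ‖β‖) (by
      intro p q
      have h1 := β.le_opNorm₂ p.1 q.1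
      have h2 := β.le_opNorm₂ p.1 q.2
      have h3 := β.le_opNorm₂ p.2 q.1
      have a1 : ‖p.1‖ ≤ ‖p‖ := norm_fst_le p
      have a2 : ‖p.2‖ ≤ ‖p‖ := norm_snd_le p
      have a3 : ‖q.1‖ ≤ ‖q‖ := norm_fst_le q
      have a4 : ‖q.2‖ ≤ ‖q‖ := norm_snd_le q
      have b1 : ‖β‖ * ‖p.1‖ * ‖q.1‖ ≤ ‖β‖ * ‖p‖ * ‖q‖ := by gcongr
      have b2 : ‖β‖ * ‖p.1‖ * ‖q.2‖ ≤ ‖β‖ * ‖p‖ * ‖q‖ := by gcongr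
      have b3 : ‖β‖ * ‖p.2‖ * ‖q.1‖ ≤ ‖β‖ * ‖p‖ * ‖q‖ := by gcongr
      have b0 : 0 ≤ ‖β‖ * ‖p‖ * ‖q‖ := by positivity
      simp only [LinearMap.mk₂_apply, Prod.norm_mk, sup_le_iff]
      constructor
      · linarith
      · refine (norm_add_le _ _).trans ?_
        linarith)

lemma TB_QF (β : E →L[ℝ] E →L[ℝ] E) (g : E) (p : E × E) :
    QF (TB β) (g, 0) p = (QF β g p.1, DQ β p.1 p.2) := by
  ext <;> simp [QF, TB, DQ]

lemma TB_apriori (hA : Apriori β g) : Apriori (TB β) (g, 0) := by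
  intro r T
  obtain ⟨R, hR⟩ := hA r T
  refine ⟨max R (r * Real.exp (2 * ‖β‖ * |R| * |T|)), fun χ hχ γ h0 hγ t ht => ?_⟩
  have e1 : ∀ t ∈ Icc (-T) T, HasDerivWithinAt (fun s => (γ s).1) (χ t • QF β g (γ t).1)
      (Icc (-T) T) t := by
    intro t ht
    have := hγ t ht
    rw [TB_QF] at this
    exact this.fst
  have e2 : ∀ t ∈ Icc (-T) T, HasDerivWithinAt (fun s => (γ s).2) (χ t • DQ β (γ t).1 (γ t).2)
      (Icc (-T) T) t := by
    intro t ht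
    have := hγ t ht
    rw [TB_QF] at this
    exact this.snd
  have b1 := hR χ hχ (fun s => (γ s).1) ((norm_fst_le _).trans h0) e1
  have b2 := gron_two e2 ((norm_snd_le _).trans h0) (K := 2 * ‖β‖ * |R|) (ε := 0) (by
    intro s hs
    have h1 := β.le_opNorm₂ (γ s).1 (γ s).2
    have h2 := β.le_opNorm₂ (γ s).2 (γ s).1
    have h3 : ‖(γ s).1‖ ≤ |R| := (b1 s hs).trans (le_abs_self R)
    rw [norm_smul, Real.norm_of_nonneg (hχ s).1, DQ_apply]
    calc _ ≤ 1 * ‖β (γ s).1 (γ s).2 + β (γ s).2 (γ s).1‖ := by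
          gcongr
          exact (hχ s).2
      _ ≤ ‖β (γ s).1 (γ s).2‖ + ‖β (γ s).2 (γ s).1‖ := by
          rw [one_mul]; exact norm_add_le _ _
      _ ≤ ‖β‖ * ‖(γ s).1‖ * ‖(γ s).2‖ + ‖β‖ * ‖(γ s).2‖ * ‖(γ s).1‖ := add_le_add h1 h2
      _ ≤ ‖β‖ * |R| * ‖(γ s).2‖ + ‖β‖ * ‖(γ s).2‖ * |R| := by gcongr
      _ = _ := by ring) t ht
  rw [gronwallBound_ε0] at b2
  have hr : 0 ≤ r := (norm_nonneg _).trans h0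
  rw [Prod.norm_def]
  apply max_le_max (b1 t ht)
  refine b2.trans ?_
  have : |t| ≤ |T| := (abs_le.mpr ht).trans (le_abs_self T)
  gcongr

variable [FiniteDimensional ℝ E]

lemma exists_tangent (h : IsFlow β g φ) (hA : Apriori β g) :
    ∃ ψ : ℝ → E → E →L[ℝ] E, (∀ x, ψ 0 x = ContinuousLinearMap.id ℝ E) ∧
      (∀ t x v, HasDerivAt (fun s => ψ s x v) (DQ β (φ t x) (ψ t x v)) t) ∧
      Continuous (fun p : ℝ × E => ψ p.1 p.2) := by
  have hA2 := TB_apriori hA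
  obtain ⟨Φ, z, d⟩ := exists_flow (TB β) (g, 0) hA2
  have hΦ : IsFlow (TB β) (g, 0) Φ := ⟨z, d⟩
  have f1 : ∀ t p, (Φ t p).1 = φ t p.1 := by
    intro t p
    have := h.uniq hA (γ := fun s => (Φ s p).1) (fun s => by
      have := d s p
      rw [TB_QF] at this
      exact this.fst) t
    simpa [z] using this
  have f2 : ∀ t p, HasDerivAt (fun s => (Φ s p).2) (DQ β (φ t p.1) (Φ t p).2) t := by
    intro t p
    have := d t p
    rw [TB_QF] at this
    rw [← f1]
    exact this.snd
  have lin : ∀ t x (c : ℝ) v w, (Φ t (x, c • v + w)).2 = c • (Φ t (x, v)).2 + (Φ t (x, w)).2 := by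
    intro t x c v w
    have := hΦ.uniq hA2 (γ := fun s => (φ s x, c • (Φ s (x, v)).2 + (Φ s (x, w)).2)) (fun s => by
      rw [TB_QF]
      apply (h.deriv s x).prodMk
      have := ((f2 s (x, v)).const_smul c).add (f2 s (x, w))
      convert! this using 1
      simp) t
    simp only [h.zero, z] at this
    rw [← this]
  let ψ : ℝ → E → E →L[ℝ] E := fun t x => LinearMap.toContinuousLinearMap
    { toFun := fun v => (Φ t (x, v)).2
      map_add' := fun v w => by simpa using lin t x 1 v w
      map_smul' := fun c v => by
        have h0 : (Φ t (x, 0)).2 = 0 := by simpa using lin t x 1 0 0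
        simpa [h0] using lin t x c v 0 }
  have hψ : ∀ t x v, ψ t x v = (Φ t (x, v)).2 := fun t x v => rfl
  refine ⟨ψ, ?_, ?_, ?_⟩
  · intro x; ext v; simp [hψ, z]
  · intro t x v
    simp only [hψ]
    exact f2 t (x, v)
  · rw [continuous_clm_apply]
    intro v
    simp only [hψ]
    have := hΦ.cont hA2
    exact continuous_snd.comp (this.comp (f := fun p : ℝ × E => (p.1, (p.2, v))) (by fun_prop))

lemma flow_hasFDerivAt (h : IsFlow β g φ) (hA : Apriori β g) {ψ : ℝ → E → E →L[ℝ] E}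
    (hψ0 : ∀ x, ψ 0 x = ContinuousLinearMap.id ℝ E)
    (hψ : ∀ t x v, HasDerivAt (fun s => ψ s x v) (DQ β (φ t x) (ψ t x v)) t)
    (t : ℝ) (x : E) : HasFDerivAt (φ t) (ψ t x) x := by
  obtain ⟨R, hR0, hR⟩ := h.bdd hA (‖x‖ + 1) |t|
  obtain ⟨K, hK⟩ := h.lip hA (‖x‖ + 1) |t|
  have ht : t ∈ Icc (-|t|) |t| := ⟨neg_abs_le t, le_abs_self t⟩
  have key : ∃ C : ℝ, ∀ v : E, ‖v‖ ≤ 1 → ‖φ t (x + v) - φ t x - ψ t x v‖ ≤ C * ‖v‖ ^ 2 := by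
    refine ⟨‖β‖ * K ^ 2 / (2 * ‖β‖ * R + 1) * (Real.exp ((2 * ‖β‖ * R + 1) * |t|) - 1),
      fun v hv => ?_⟩
    have hxv : ‖x + v‖ ≤ ‖x‖ + 1 := (norm_add_le _ _).trans (by linarith)
    have hw : ∀ s ∈ Icc (-|t|) |t|, ‖φ s (x + v) - φ s x‖ ≤ K * ‖v‖ := by
      intro s hs
      have := (hK s hs).dist_le_mul (x + v) (by simpa using hxv) x (by simp)
      simpa [dist_eq_norm] using this
    have := gron_two (T := |t|) (f := fun s => φ s (x + v) - φ s x - ψ s x v)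
      (f' := fun s => QF β g (φ s (x + v)) - QF β g (φ s x) - DQ β (φ s x) (ψ s x v))
      (δ := 0) (K := 2 * ‖β‖ * R + 1) (ε := ‖β‖ * (K * ‖v‖) ^ 2)
      (fun s _ => (((h.deriv s (x + v)).sub (h.deriv s x)).sub (hψ s x v)).hasDerivWithinAt)
      (by simp [h.zero, hψ0]) (fun s hs => by
        set w := φ s (x + v) - φ s x with hwdef
        set e := w - ψ s x v with he
        have e1 : QF β g (φ s (x + v)) - QF β g (φ s x) - DQ β (φ s x) (ψ s x v)
            = (β (φ s x) e + β e (φ s x)) + β w w := by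
          have : φ s (x + v) = φ s x + w := by simp [hwdef]
          rw [this]
          simp only [QF, DQ_apply, he, map_add, map_sub, _root_.add_apply,
            _root_.sub_apply]
          abel
        rw [e1]
        have h1 := β.le_opNorm₂ (φ s x) e
        have h2 := β.le_opNorm₂ e (φ s x)
        have h3 := β.le_opNorm₂ w w
        have h4 := hR x (by linarith) s hs
        have h5 := hw s hs
        calc _ ≤ ‖β (φ s x) e‖ + ‖β e (φ s x)‖ + ‖β w w‖ := norm_add₃_le
          _ ≤ ‖β‖ * ‖φ s x‖ * ‖e‖ + ‖β‖ * ‖e‖ * ‖φ s x‖ + ‖β‖ * ‖w‖ * ‖w‖ := by gcongr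
          _ ≤ ‖β‖ * R * ‖e‖ + ‖β‖ * ‖e‖ * R + ‖β‖ * (K * ‖v‖) * (K * ‖v‖) := by gcongr
          _ ≤ _ := by nlinarith [norm_nonneg e]) t ht
    rw [gronwallBound_of_K_ne_0 (by positivity)] at this
    simp only [zero_mul, zero_add] at this
    refine this.trans (le_of_eq ?_)
    ring
  obtain ⟨C, hC⟩ := key
  rw [hasFDerivAt_iff_isLittleO_nhds_zero]
  have hO : (fun v : E => φ t (x + v) - φ t x - ψ t x v) =O[𝓝 0] (fun v => ‖v‖ ^ 2) := by
    apply Asymptotics.IsBigO.of_bound C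
    filter_upwards [closedBall_mem_nhds (0 : E) one_pos] with v hv
    simpa using hC v (by simpa using hv)
  refine hO.trans_isLittleO ?_
  have := (Asymptotics.isLittleO_pow_id (𝕜 := ℝ) (n := 2) (by norm_num)).comp_tendsto
    (tendsto_norm_zero (E := E))
  exact Asymptotics.IsLittleO.of_norm_right (by simpa [Function.comp_def] using this)

/-- Smooth flow data. -/
structure SFlow (β : E →L[ℝ] E →L[ℝ] E) (g : E) (φ : ℝ → E → E) (ψ : ℝ → E → E →L[ℝ] E) : Prop
    extends IsFlow β g φ where
  apr : Apriori β g
  psi_zero : ∀ x, ψ 0 x = ContinuousLinearMap.id ℝ E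
  psi_deriv : ∀ t x v, HasDerivAt (fun s => ψ s x v) (DQ β (φ t x) (ψ t x v)) t
  psi_cont : Continuous (fun p : ℝ × E => ψ p.1 p.2)
  fd : ∀ t x, HasFDerivAt (φ t) (ψ t x) x

lemma exists_sflow (hA : Apriori β g) : ∃ φ ψ, SFlow β g φ ψ := by
  obtain ⟨φ, z, d⟩ := exists_flow β g hA
  obtain ⟨ψ, a, b, c⟩ := exists_tangent ⟨z, d⟩ hA
  exact ⟨φ, ψ, ⟨z, d⟩, hA, a, b, c, flow_hasFDerivAt ⟨z, d⟩ hA a b⟩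

variable {ψ : ℝ → E → E →L[ℝ] E}

lemma SFlow.strict (h : SFlow β g φ ψ) (t : ℝ) (x : E) :
    HasStrictFDerivAt (fun p : ℝ × E => φ p.1 p.2)
      ((ContinuousLinearMap.toSpanSingleton ℝ (QF β g (φ t x))).coprod (ψ t x)) (t, x) := by
  have := hasStrictFDerivAt_uncurry_coprod (𝕜 := ℝ) (u := (t, x)) (f := φ)
    (f₁ := fun t x => ContinuousLinearMap.toSpanSingleton ℝ (QF β g (φ t x))) (f₂ := ψ)
    (Eventually.of_forall fun p => (h.deriv p.1 p.2).hasFDerivAt)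
    (Eventually.of_forall fun p => h.fd p.1 p.2)
    (by
      have c := h.toIsFlow.cont h.apr
      have c2 : Continuous fun p : ℝ × E => QF β g (φ p.1 p.2) :=
        (QF_contDiff β g (k := 0)).continuous.comp c
      have c3 : Continuous fun p : ℝ × E =>
          ContinuousLinearMap.toSpanSingleton ℝ (QF β g (φ p.1 p.2)) := by
        rw [continuous_clm_apply]
        intro y
        simp only [ContinuousLinearMap.toSpanSingleton_apply]
        fun_prop
      exact c3.continuousAt) h.psi_cont.continuousAt
  exact this

lemma SFlow.psi_add (h : SFlow β g φ ψ) (s t : ℝ) (x : E) :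
    ψ (s + t) x = (ψ s (φ t x)).comp (ψ t x) := by
  have h1 := h.fd (s + t) x
  have h2 := (h.fd s (φ t x)).comp x (h.fd t x)
  have e : φ (s + t) = φ s ∘ φ t := by ext y; exact h.toIsFlow.add h.apr s t y
  rw [e] at h1
  exact h1.unique h2

lemma SFlow.psi_neg_left (h : SFlow β g φ ψ) (t : ℝ) (x v : E) :
    ψ (-t) (φ t x) (ψ t x v) = v := by
  have := h.psi_add (-t) t x
  rw [neg_add_cancel, h.psi_zero] at this
  exact (DFunLike.congr_fun this v).symm

/-- The field is invariant under its own flow. -/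
lemma SFlow.psi_field (h : SFlow β g φ ψ) (t : ℝ) (x : E) :
    ψ t x (QF β g x) = QF β g (φ t x) := by
  have h1 := (h.deriv 0 x).hasFDerivAt
  have h2 := (h.fd t (φ 0 x)).comp_hasDerivAt 0 (h.deriv 0 x)
  have e : (φ t ∘ fun s => φ s x) = fun s => φ (s + t) x := by
    ext s
    simp only [Function.comp]
    rw [← h.toIsFlow.add h.apr, add_comm]
  rw [e] at h2
  have h3 : HasDerivAt (fun s => φ (s + t) x) (QF β g (φ (0 + t) x)) 0 :=
    (h.deriv (0 + t) x).comp_add_const 0 t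
  have := h2.unique h3
  simpa [h.zero] using this

end PartTwo

section PartThree
set_option linter.unusedSectionVars false
open Filter Topology Metric MeasureTheory
open scoped NNReal

/-- Derivative of the determinant at the identity. -/
lemma det_hasDerivAt_matrix {ι : Type*} [Fintype ι] [DecidableEq ι] {M : ℝ → ι → ι → ℝ}
    {M' : ι → ι → ℝ} (h0 : M 0 = fun i j => (1 : Matrix ι ι ℝ) i j) (hM : HasDerivAt M M' 0) :
    HasDerivAt (fun t => Matrix.det (Matrix.of (M t))) (Matrix.trace (Matrix.of M')) 0 := by
  let D : (ι → ι → ℝ) → ℝ := fun M => Matrix.det (Matrix.of M)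
  have hD : Differentiable ℝ D := by
    show Differentiable ℝ fun M : ι → ι → ℝ => Matrix.det (Matrix.of M)
    simp only [Matrix.det_apply, Matrix.of_apply]
    fun_prop
  have h1 := (hD (M 0)).hasFDerivAt.comp_hasDerivAt 0 hM
  have h2 : HasDerivAt (fun t : ℝ => M 0 + t • M') M' 0 := by
    simpa using ((hasDerivAt_id (0 : ℝ)).smul_const M').const_add (M 0)
  have h3 := (hD (M 0 + (0 : ℝ) • M')).hasFDerivAt.comp_hasDerivAt 0 h2
  have h4 : HasDerivAt (D ∘ fun t : ℝ => M 0 + t • M') (Matrix.trace (Matrix.of M')) 0 := by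
    have e : (D ∘ fun t : ℝ => M 0 + t • M') = fun t : ℝ => 1 + Matrix.trace (Matrix.of M') * t +
        (Polynomial.eval t ((Matrix.det (1 + (Polynomial.X : Polynomial ℝ) •
          (Matrix.of M').map Polynomial.C)).divX.divX)) * t ^ 2 := by
      ext t
      have := Matrix.det_one_add_smul t (Matrix.of M')
      rw [← this]
      simp only [D, Function.comp, h0]
      congr 1
    rw [e]
    have q : HasDerivAt (fun t : ℝ => (Polynomial.eval t ((Matrix.det (1 + (Polynomial.X : Polynomial ℝ) •
          (Matrix.of M').map Polynomial.C)).divX.divX)) * t ^ 2) 0 0 := by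
      have := (Polynomial.hasDerivAt ((Matrix.det (1 + (Polynomial.X : Polynomial ℝ) •
          (Matrix.of M').map Polynomial.C)).divX.divX) (0 : ℝ)).mul (hasDerivAt_pow 2 (0 : ℝ))
      simpa [Pi.mul_def] using this
    have := (((hasDerivAt_id (0 : ℝ)).const_mul (Matrix.trace (Matrix.of M'))).const_add 1).add q
    simpa [Pi.add_def] using this
  have h5 := h3.unique h4
  simp only [zero_smul, add_zero] at h5
  rw [h5] at h1
  exact h1

variable {E : Type*} [NormedAddCommGroup E]

lemma det_hasDerivAt [NormedSpace ℝ E] [FiniteDimensional ℝ E] {A : ℝ → E →L[ℝ] E} {A' : E →L[ℝ] E}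
    (h0 : A 0 = ContinuousLinearMap.id ℝ E) (hA : ∀ v, HasDerivAt (fun t => A t v) (A' v) 0) :
    HasDerivAt (fun t => (A t).det) (LinearMap.trace ℝ E A') 0 := by
  let b := Module.finBasis ℝ E
  have h1 := det_hasDerivAt_matrix (M := fun t i j => LinearMap.toMatrix b b (A t : E →ₗ[ℝ] E) i j)
    (M' := fun i j => LinearMap.toMatrix b b (A' : E →ₗ[ℝ] E) i j)
    (by ext i j; rw [h0]; simp [LinearMap.toMatrix_apply, Matrix.one_apply, Finsupp.single_apply, eq_comm]) (by
      rw [hasDerivAt_pi]; intro i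
      rw [hasDerivAt_pi]; intro j
      simp only [LinearMap.toMatrix_apply]
      have := (LinearMap.toContinuousLinearMap (b.coord i)).hasFDerivAt.comp_hasDerivAt 0 (hA (b j))
      exact this)
  rw [LinearMap.trace_eq_matrix_trace ℝ b]
  convert! h1 using 2
  rename_i t
  show LinearMap.det (A t : E →ₗ[ℝ] E) = _
  rw [← LinearMap.det_toMatrix b]
  rfl

variable [InnerProductSpace ℝ E]

lemma apriori_of_energy {β : E →L[ℝ] E →L[ℝ] E} (hE : ∀ x, inner ℝ x (β x x) = 0) (g : E) :
    Apriori β g := by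
  intro r T
  refine ⟨(1 + r ^ 2) * Real.exp (‖g‖ * |T|), fun χ hχ γ h0 hγ t ht => ?_⟩
  have hd : ∀ t ∈ Icc (-T) T, HasDerivWithinAt (fun s => 1 + inner ℝ (γ s) (γ s))
      (2 * χ t * inner ℝ (γ t) g) (Icc (-T) T) t := by
    intro t ht
    have := ((hγ t ht).inner ℝ (hγ t ht)).const_add 1
    convert! this using 1
    rw [real_inner_comm (γ t) (χ t • _)]
    simp only [QF, inner_smul_right, inner_add_right, hE]
    ring
  have := gron_two hd (δ := 1 + r ^ 2) (K := ‖g‖) (ε := 0) (by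
      rw [real_inner_self_eq_norm_sq, Real.norm_of_nonneg (by positivity)]
      gcongr) (fun s hs => by
      rw [real_inner_self_eq_norm_sq, Real.norm_of_nonneg (r := 1 + ‖γ s‖ ^ 2) (by positivity), norm_mul,
        norm_mul, Real.norm_of_nonneg (hχ s).1]
      have h1 := norm_inner_le_norm (𝕜 := ℝ) (γ s) g
      have h2 := hχ s
      calc ‖(2 : ℝ)‖ * χ s * ‖inner ℝ (γ s) g‖ ≤ 2 * 1 * (‖γ s‖ * ‖g‖) := by
            rw [Real.norm_of_nonneg (by norm_num : (0 : ℝ) ≤ 2)]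
            have := norm_nonneg (inner ℝ (γ s) g)
            gcongr
            exact h2.2
        _ ≤ _ := by nlinarith [sq_nonneg (‖γ s‖ - 1), norm_nonneg g, mul_nonneg (norm_nonneg g) (sq_nonneg (‖γ s‖ - 1))]) t ht
  rw [gronwallBound_ε0, real_inner_self_eq_norm_sq, Real.norm_of_nonneg (by positivity)] at this
  have h3 : |t| ≤ |T| := (abs_le.mpr ht).trans (le_abs_self T)
  have h4 : (1 + r ^ 2) * Real.exp (‖g‖ * |t|) ≤ (1 + r ^ 2) * Real.exp (‖g‖ * |T|) := by gcongr
  nlinarith [sq_nonneg (‖γ t‖ - 1)]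

variable [FiniteDimensional ℝ E] {β : E →L[ℝ] E →L[ℝ] E} {φ : ℝ → E → E} {ψ : ℝ → E → E →L[ℝ] E}

lemma flow_norm (hE : ∀ x, inner ℝ x (β x x) = 0) (h : SFlow β 0 φ ψ) (t : ℝ) (x : E) :
    ‖φ t x‖ = ‖x‖ := by
  have hd : ∀ t, HasDerivAt (fun s => inner ℝ (φ s x) (φ s x)) 0 t := by
    intro t
    have := (h.deriv t x).inner ℝ (h.deriv t x)
    convert! this using 1
    rw [real_inner_comm (φ t x) (QF β 0 _)]
    simp [QF, hE]
  have := is_const_of_deriv_eq_zero (f := fun s => inner ℝ (φ s x) (φ s x))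
    (fun t => (hd t).differentiableAt) (fun t => (hd t).deriv) t 0
  simp only [real_inner_self_eq_norm_sq, h.zero] at this
  exact (sq_eq_sq₀ (norm_nonneg _) (norm_nonneg _)).mp this

lemma flow_det (hT : ∀ x, LinearMap.trace ℝ E (DQ β x) = 0) {g : E} (h : SFlow β g φ ψ) (t : ℝ) (x : E) :
    (ψ t x).det = 1 := by
  have hd : ∀ t, HasDerivAt (fun s => (ψ s x).det) 0 t := by
    intro t
    have h1 := det_hasDerivAt (A := fun s => ψ s (φ t x)) (h.psi_zero _) (A' := DQ β (φ t x))
      (fun v => by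
        have := h.psi_deriv 0 (φ t x) v
        simpa [h.psi_zero, h.zero] using this)
    rw [hT] at h1
    have h2 : HasDerivAt (fun s => (ψ s (φ t x)).det * (ψ t x).det) 0 (t - t) := by
      simpa using h1.mul_const (ψ t x).det
    have h3 := h2.comp_sub_const t t
    convert! h3 using 1
    ext s
    have := h.psi_add (s - t) t x
    rw [sub_add_cancel] at this
    rw [this]
    exact LinearMap.det_comp _ _
  have := is_const_of_deriv_eq_zero (f := fun s => (ψ s x).det)
    (fun t => (hd t).differentiableAt) (fun t => (hd t).deriv) t 0
  simp only [h.psi_zero] at this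
  rw [this]
  exact LinearMap.det_id

/-- Poincaré recurrence for the drift. -/
lemma flow_recurrent (hE : ∀ x, inner ℝ x (β x x) = 0)
    (hT : ∀ x, LinearMap.trace ℝ E (DQ β x) = 0) (h : SFlow β 0 φ ψ) {U : Set E} (hU : IsOpen U)
    (hne : U.Nonempty) {s : ℝ} (hs : 0 < s) : ∃ x ∈ U, ∃ t, s ≤ t ∧ φ t x ∈ U := by
  let _ : MeasurableSpace E := borel E
  have : BorelSpace E := ⟨rfl⟩
  let μ : Measure E := Measure.addHaar
  have hc : ∀ t, Continuous (φ t) := fun t =>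
    (h.toIsFlow.cont h.apr).comp (f := fun x : E => (t, x)) (by fun_prop)
  have hinj : ∀ t, Function.Injective (φ t) := fun t =>
    Function.LeftInverse.injective (g := φ (-t)) (h.toIsFlow.neg_left h.apr t)
  have mp : MeasurePreserving (φ s) μ μ := by
    refine ⟨(hc s).measurable, ?_⟩
    ext A hA
    rw [Measure.map_apply (hc s).measurable hA]
    have e : φ s ⁻¹' A = Set.image (φ (-s)) A := by
      ext x; constructor
      · intro hx; exact ⟨φ s x, hx, h.toIsFlow.neg_left h.apr s x⟩
      · rintro ⟨y, hy, rfl⟩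
        show φ s (φ (-s) y) ∈ A
        rwa [h.toIsFlow.neg_right h.apr s y]
    rw [e, ← lintegral_abs_det_fderiv_eq_addHaar_image μ hA
      (fun x _ => (h.fd (-s) x).hasFDerivWithinAt) ((hinj (-s)).injOn)]
    simp [flow_det hT h]
  obtain ⟨x₀, hx₀⟩ := hne
  let B : Set E := ball 0 (‖x₀‖ + 1)
  have hB : φ s ⁻¹' B = B := by
    ext x; simp [B, flow_norm hE h]
  have mp2 := mp.restrict_preimage (s := B) isOpen_ball.measurableSet
  rw [hB] at mp2
  have : IsFiniteMeasure (μ.restrict B) := ⟨by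
    rw [Measure.restrict_apply_univ]; exact measure_ball_lt_top⟩
  have hcons := mp2.conservative
  have hpos : μ.restrict B (U ∩ B) ≠ 0 := by
    rw [Measure.restrict_apply (hU.inter isOpen_ball).measurableSet, inter_assoc, inter_self]
    exact ((hU.inter isOpen_ball).measure_pos μ ⟨x₀, hx₀, by simp [B]⟩).ne'
  obtain ⟨x, hx, m, hm, hxm⟩ := hcons.exists_mem_iterate_mem
    (hU.inter isOpen_ball).measurableSet.nullMeasurableSet hpos
  refine ⟨x, hx.1, m * s, ?_, ?_⟩
  · have : (1 : ℝ) ≤ m := by exact_mod_cast Nat.one_le_iff_ne_zero.mpr hm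
    nlinarith
  · have : ∀ k : ℕ, (φ s)^[k] x = φ (k * s) x := by
      intro k
      induction k with
      | zero => simp [h.zero]
      | succ k ih =>
        rw [Function.iterate_succ_apply', ih, ← h.toIsFlow.add h.apr]
        congr 1; push_cast; ring
    rw [← this]; exact hxm.1

end PartThree

section PartFour
set_option linter.unusedSectionVars false
open Filter Topology Metric
open scoped NNReal ContDiff

variable {E : Type*} [NormedAddCommGroup E] [NormedSpace ℝ E]

/-- Reachability by finitely many pieces of controlled flows with bounded controls. -/
def Rch (φ : ℝ → ℝ → E → E) (b : ℝ) : E → E → Prop :=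
  Relation.ReflTransGen (fun x y => ∃ u s : ℝ, |u| ≤ b ∧ 0 ≤ s ∧ y = φ u s x)

/-- A pair consisting of a reachable point and a tangent space of the reachable set there. -/
def TP (φ : ℝ → ℝ → E → E) (b : ℝ) (x z : E) (T : Submodule ℝ E) : Prop :=
  ∃ (F : Type) (_ : NormedAddCommGroup F) (_ : NormedSpace ℝ F) (_ : CompleteSpace F)
    (γ : F → E) (p : F) (γ' : F →L[ℝ] E), γ p = z ∧ HasStrictFDerivAt γ γ' p ∧
      (∀ᶠ q in 𝓝 p, Rch φ b x (γ q)) ∧ LinearMap.range (γ' : F →ₗ[ℝ] E) = T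

variable {β : E →L[ℝ] E →L[ℝ] E} {G : E} {b : ℝ} {φ : ℝ → ℝ → E → E} {ψ : ℝ → ℝ → E → E →L[ℝ] E}

lemma Rch.step {x y : E} (h : Rch φ b x y) {u s : ℝ} (hu : |u| ≤ b) (hs : 0 ≤ s) :
    Rch φ b x (φ u s y) := Relation.ReflTransGen.tail h ⟨u, s, hu, hs, rfl⟩

lemma TP.base (x : E) : TP φ b x x ⊥ := by
  refine ⟨PUnit, inferInstance, inferInstance, inferInstance, fun _ => x, PUnit.unit, 0, rfl,
    hasStrictFDerivAt_const _ _, Eventually.of_forall fun _ => Relation.ReflTransGen.refl, ?_⟩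
  simp

variable [FiniteDimensional ℝ E]

lemma TP.push (hφ : ∀ u, SFlow β (u • G) (φ u) (ψ u)) {x z : E} {T : Submodule ℝ E}
    (h : TP φ b x z T) {u s : ℝ} (hu : |u| ≤ b) (hs : 0 ≤ s) :
    TP φ b x (φ u s z) (T.map (ψ u s z : E →ₗ[ℝ] E)) := by
  obtain ⟨F, i1, i2, i3, γ, p, γ', rfl, hd, hr, rfl⟩ := h
  refine ⟨F, i1, i2, i3, fun q => φ u s (γ q), p, (ψ u s (γ p)).comp γ', rfl, ?_, ?_, ?_⟩
  · have h1 := (hφ u).strict s (γ p)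
    have h2 : HasStrictFDerivAt (fun q => (s, γ q)) ((0 : F →L[ℝ] ℝ).prod γ') p :=
      (hasStrictFDerivAt_const s p).prodMk hd
    have h3 := HasStrictFDerivAt.comp p h1 h2
    convert! h3 using 1
    ext v
    simp
  · exact hr.mono fun q hq => hq.step hu hs
  · rw [ContinuousLinearMap.toLinearMap_comp, LinearMap.range_comp]

lemma TP.addX (hφ : ∀ u, SFlow β (u • G) (φ u) (ψ u)) {x z : E} {T : Submodule ℝ E}
    (h : TP φ b x z T) {u s : ℝ} (hu : |u| ≤ b) (hs : 0 < s) :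
    TP φ b x (φ u s z) (T.map (ψ u s z : E →ₗ[ℝ] E) ⊔
      Submodule.span ℝ {QF β (u • G) (φ u s z)}) := by
  obtain ⟨F, i1, i2, i3, γ, p, γ', rfl, hd, hr, rfl⟩ := h
  refine ⟨F × ℝ, inferInstance, inferInstance, inferInstance, fun q => φ u q.2 (γ q.1), (p, s),
    ((ψ u s (γ p)).comp γ').coprod
      (ContinuousLinearMap.toSpanSingleton ℝ (QF β (u • G) (φ u s (γ p)))), rfl, ?_, ?_, ?_⟩
  · have h1 := (hφ u).strict s (γ p)
    have h2 : HasStrictFDerivAt (fun q : F × ℝ => (q.2, γ q.1))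
        ((ContinuousLinearMap.snd ℝ F ℝ).prod (γ'.comp (ContinuousLinearMap.fst ℝ F ℝ))) (p, s) :=
      hasStrictFDerivAt_snd.prodMk
        (HasStrictFDerivAt.comp (p, s) (f := fun q : F × ℝ => q.1) hd hasStrictFDerivAt_fst)
    have h3 := HasStrictFDerivAt.comp (p, s) (f := fun q : F × ℝ => (q.2, γ q.1)) h1 h2
    convert! h3 using 1
    ext v
    · simp
    · simp
  · have e1 : ∀ᶠ q : F × ℝ in 𝓝 (p, s), Rch φ b x (γ q.1) :=
      (continuous_fst.tendsto (p, s)).eventually hr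
    have e2 : ∀ᶠ q : F × ℝ in 𝓝 (p, s), 0 < q.2 :=
      (continuous_snd.tendsto (p, s)).eventually (lt_mem_nhds hs)
    filter_upwards [e1, e2] with q h1 h2
    exact h1.step hu h2.le
  · rw [ContinuousLinearMap.coe_coprod, LinearMap.range_coprod, ContinuousLinearMap.toLinearMap_comp,
      LinearMap.range_comp]
    congr 1
    ext w
    simp [Submodule.mem_span_singleton]

lemma clm_hasDerivAt {A : ℝ → E →L[ℝ] E} {A' : E →L[ℝ] E} {t : ℝ}
    (hA : ∀ v, HasDerivAt (fun t => A t v) (A' v) t) : HasDerivAt A A' t := by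
  let B := Module.finBasis ℝ E
  have key : ∀ L : E →L[ℝ] E, L = ∑ i, (ContinuousLinearMap.smulRightL ℝ E E
      (LinearMap.toContinuousLinearMap (B.coord i))) (L (B i)) := by
    intro L
    ext v
    simp only [_root_.sum_apply, ContinuousLinearMap.smulRightL_apply_apply,
      LinearMap.coe_toContinuousLinearMap', Module.Basis.coord_apply]
    conv_lhs => rw [← B.sum_repr v]
    rw [map_sum]
    simp only [map_smul]
    simp
  have h1 : HasDerivAt (fun t => ∑ i, (ContinuousLinearMap.smulRightL ℝ E E
      (LinearMap.toContinuousLinearMap (B.coord i))) (A t (B i)))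
      (∑ i, (ContinuousLinearMap.smulRightL ℝ E E
      (LinearMap.toContinuousLinearMap (B.coord i))) (A' (B i))) t :=
    HasDerivAt.fun_sum fun i _ => (ContinuousLinearMap.hasFDerivAt _).comp_hasDerivAt t (hA (B i))
  rw [← key A'] at h1
  convert! h1 using 1
  ext1 s
  exact key (A s)

lemma QF_fderiv (g x : E) : fderiv ℝ (QF β g) x = DQ β x := by
  have : HasFDerivAt (QF β g) (DQ β x) x := by
    have := (HasFDerivAt.comp x (f := fun y : E => (y, y)) (β.isBoundedBilinearMap.hasFDerivAt (x, x))
      ((hasFDerivAt_id (𝕜 := ℝ) x).prodMk (hasFDerivAt_id x))).add_const g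
    convert! this using 1
  exact this.fderiv

/-- The infinitesimal step: pulling back along the flow differentiates to a bracket. -/
lemma bracket_mem {g : E} {φ : ℝ → E → E} {ψ : ℝ → E → E →L[ℝ] E} (h : SFlow β g φ ψ)
    {Y : E → E} (hY : Differentiable ℝ Y) {z : E} {T : Submodule ℝ E}
    (hT : ∀ s, 0 ≤ s → Y (φ s z) ∈ T.map (ψ s z : E →ₗ[ℝ] E)) :
    VectorField.lieBracket ℝ (QF β g) Y z ∈ T := by
  set w : ℝ → E := fun s => ψ (-s) (φ s z) (Y (φ s z)) with hw
  have hφc : Continuous fun s => φ s z :=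
    (h.toIsFlow.cont h.apr).comp (by fun_prop : Continuous fun s : ℝ => (s, z))
  have hwT : ∀ s, 0 ≤ s → w s ∈ T := by
    intro s hs
    obtain ⟨v, hv, e⟩ := hT s hs
    have : w s = v := by
      simp only [hw]
      rw [← e]
      exact h.psi_neg_left s z v
    rwa [this]
  have hwA : ∀ s, 0 ≤ s → ψ s z (w s) = Y (φ s z) := by
    intro s hs
    obtain ⟨v, hv, e⟩ := hT s hs
    have : w s = v := by
      simp only [hw]
      rw [← e]
      exact h.psi_neg_left s z v
    rw [this]; exact e
  have hw0 : w 0 = Y z := by simp [hw, h.zero, h.psi_zero]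
  have hwc : Continuous w := by
    have c1 : Continuous fun s : ℝ => ψ (-s) (φ s z) :=
      h.psi_cont.comp (by fun_prop : Continuous fun s : ℝ => (-s, φ s z))
    exact c1.clm_apply (hY.continuous.comp hφc)
  have hA : HasDerivAt (fun s => ψ s z) (DQ β z) 0 := by
    apply clm_hasDerivAt
    intro v
    have := h.psi_deriv 0 z v
    simpa [h.zero, h.psi_zero] using this
  have hy : HasDerivAt (fun s => Y (φ s z)) (fderiv ℝ Y z (QF β g z)) 0 := by
    have h1 := h.deriv 0 z
    have h2 := (hY (φ 0 z)).hasFDerivAt.comp_hasDerivAt 0 h1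
    simpa [h.zero] using! h2
  have t1 := hasDerivAt_iff_tendsto_slope.1 hy
  have t2 := hasDerivAt_iff_tendsto_slope.1 hA
  have t3 : Tendsto w (𝓝[≠] 0) (𝓝 (Y z)) := by
    rw [← hw0]; exact (hwc.tendsto 0).mono_left nhdsWithin_le_nhds
  have t4 : Tendsto (fun s => slope (fun s => Y (φ s z)) 0 s - (slope (fun s => ψ s z) 0 s) (w s))
      (𝓝[≠] 0) (𝓝 (fderiv ℝ Y z (QF β g z) - DQ β z (Y z))) := by
    refine t1.sub ?_
    have c : Continuous fun q : (E →L[ℝ] E) × E => q.1 q.2 := by fun_prop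
    exact (c.tendsto (DQ β z, Y z)).comp (t2.prodMk_nhds t3)
  have t5 := t4.mono_left (nhdsWithin_mono 0 (fun s (hs : s ∈ Ioi (0:ℝ)) => ne_of_gt hs))
  rw [VectorField.lieBracket, QF_fderiv]
  refine (T.closed_of_finiteDimensional).mem_of_tendsto t5 ?_
  filter_upwards [self_mem_nhdsWithin] with s hs
  have hs : 0 < s := hs
  have : slope (fun s => Y (φ s z)) 0 s - (slope (fun s => ψ s z) 0 s) (w s)
      = s⁻¹ • (w s - w 0) := by
    simp only [slope_def_module, sub_zero, _root_.smul_apply,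
      _root_.sub_apply, h.psi_zero, h.zero, hwA s hs.le, hw0,
      ContinuousLinearMap.id_apply, ← smul_sub]
    congr 1
    abel
  rw [this]
  exact T.smul_mem _ (T.sub_mem (hwT s hs.le) (hwT 0 le_rfl))

lemma lb_smooth {X Y : E → E} (hX : ContDiff ℝ ∞ X) (hY : ContDiff ℝ ∞ Y) :
    ContDiff ℝ ∞ (VectorField.lieBracket ℝ X Y) :=
  hX.lieBracket_vectorField hY (by simp)

/-- Krener: the reachable set has nonempty interior. -/
theorem krener (hφ : ∀ u, SFlow β (u • G) (φ u) (ψ u)) (hb : 0 < b)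
    (hsymm : ∀ v w, β v w = β w v)
    (hG : ∀ W : Submodule ℝ E, G ∈ W → (∀ v ∈ W, ∀ w ∈ W, β v w ∈ W) → W = ⊤) (x : E) :
    (interior {y | Rch φ b x y}).Nonempty := by
  set S : Set ℕ := {k | ∃ z T, TP φ b x z T ∧ Module.finrank ℝ T = k} with hS
  have hSne : S.Nonempty := ⟨_, x, ⊥, TP.base x, rfl⟩
  have hSb : BddAbove S := ⟨Module.finrank ℝ E, by
    rintro k ⟨z, T, -, rfl⟩; exact Submodule.finrank_le T⟩
  obtain ⟨z₀, T₀, hT₀, hr₀⟩ := Nat.sSup_mem hSne hSb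
  set r := sSup S
  have hmax : ∀ z T, TP φ b x z T → Module.finrank ℝ T ≤ r := fun z T h =>
    le_csSup hSb ⟨z, T, h, rfl⟩
  let MX : E → Submodule ℝ E → Prop := fun z T => TP φ b x z T ∧ Module.finrank ℝ T = r
  have hinj : ∀ u s z, Function.Injective (ψ u s z : E →ₗ[ℝ] E) := by
    intro u s z v w hvw
    have h1 := (hφ u).psi_neg_left s z v
    have h2 := (hφ u).psi_neg_left s z w
    have h3 : ψ u s z v = ψ u s z w := hvw
    rw [← h1, ← h2, h3]
  have hpush : ∀ z T, MX z T → ∀ u s, |u| ≤ b → 0 ≤ s →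
      MX (φ u s z) (T.map (ψ u s z : E →ₗ[ℝ] E)) := by
    intro z T h u s hu hs
    refine ⟨h.1.push hφ hu hs, ?_⟩
    rw [← h.2]
    exact (LinearEquiv.finrank_eq (T.equivMapOfInjective _ (hinj u s z))).symm
  have hX : ∀ z T, MX z T → ∀ u, |u| ≤ b → QF β (u • G) z ∈ T := by
    intro z T h u hu
    have h1 := h.1.addX hφ hu one_pos
    have h2 := hmax _ _ h1
    have h3 : T.map (ψ u 1 z : E →ₗ[ℝ] E) = T.map (ψ u 1 z : E →ₗ[ℝ] E) ⊔
        Submodule.span ℝ {QF β (u • G) (φ u 1 z)} := by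
      apply Submodule.eq_of_le_of_finrank_le le_sup_left
      rw [(hpush z T h u 1 hu zero_le_one).2]
      exact h2
    have h4 : QF β (u • G) (φ u 1 z) ∈ T.map (ψ u 1 z : E →ₗ[ℝ] E) := by
      rw [h3]
      exact Submodule.mem_sup_right (Submodule.mem_span_singleton_self _)
    rw [← (hφ u).psi_field] at h4
    obtain ⟨v, hv, e⟩ := h4
    rwa [← hinj u 1 z e]
  let L : Set (E → E) := {Y | ContDiff ℝ ∞ Y ∧ ∀ z T, MX z T → Y z ∈ T}
  have Ladd : ∀ Y ∈ L, ∀ Z ∈ L, Y + Z ∈ L := fun Y hY Z hZ =>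
    ⟨hY.1.add hZ.1, fun z T h => T.add_mem (hY.2 z T h) (hZ.2 z T h)⟩
  have Lsmul : ∀ (c : ℝ), ∀ Y ∈ L, c • Y ∈ L := fun c Y hY =>
    ⟨contDiff_const.smul hY.1, fun z T h => T.smul_mem c (hY.2 z T h)⟩
  have LX : ∀ u, |u| ≤ b → QF β (u • G) ∈ L := fun u hu =>
    ⟨QF_contDiff β _, fun z T h => hX z T h u hu⟩
  have Lbr : ∀ u, |u| ≤ b → ∀ Y ∈ L, VectorField.lieBracket ℝ (QF β (u • G)) Y ∈ L := by
    intro u hu Y hY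
    refine ⟨lb_smooth (QF_contDiff β _) hY.1, fun z T h => ?_⟩
    exact bracket_mem (hφ u) (hY.1.differentiable (by simp))
      (fun s hs => hY.2 _ _ (hpush z T h u s hu hs))
  let N : Set (E → E) := {Z | ContDiff ℝ ∞ Z ∧ ∀ Y ∈ L, VectorField.lieBracket ℝ Z Y ∈ L}
  have Nadd : ∀ Y ∈ N, ∀ Z ∈ N, Y + Z ∈ N := by
    intro Y hY Z hZ
    refine ⟨hY.1.add hZ.1, fun V hV => ?_⟩
    have : VectorField.lieBracket ℝ (Y + Z) V
        = VectorField.lieBracket ℝ Y V + VectorField.lieBracket ℝ Z V := by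
      ext1 z
      exact VectorField.lieBracket_add_left (hY.1.differentiable (by simp) z)
        (hZ.1.differentiable (by simp) z)
    rw [this]
    exact Ladd _ (hY.2 V hV) _ (hZ.2 V hV)
  have Nsmul : ∀ (c : ℝ), ∀ Y ∈ N, c • Y ∈ N := by
    intro c Y hY
    refine ⟨contDiff_const.smul hY.1, fun V hV => ?_⟩
    have : VectorField.lieBracket ℝ (c • Y) V = c • VectorField.lieBracket ℝ Y V := by
      ext1 z
      exact VectorField.lieBracket_const_smul_left (hY.1.differentiable (by simp) z)
    rw [this]
    exact Lsmul c _ (hY.2 V hV)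
  have Nbr : ∀ Y ∈ N, ∀ Z ∈ N, VectorField.lieBracket ℝ Y Z ∈ N := by
    intro Y hY Z hZ
    refine ⟨lb_smooth hY.1 hZ.1, fun V hV => ?_⟩
    have : VectorField.lieBracket ℝ (VectorField.lieBracket ℝ Y Z) V
        = VectorField.lieBracket ℝ Y (VectorField.lieBracket ℝ Z V)
          + (-1 : ℝ) • VectorField.lieBracket ℝ Z (VectorField.lieBracket ℝ Y V) := by
      ext1 z
      have := VectorField.leibniz_identity_lieBracket (𝕜 := ℝ) (n := 2) (x := z)
        (by simp) (hY.1.contDiffAt.of_le (by norm_cast))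
        (hZ.1.contDiffAt.of_le (by norm_cast))
        (hV.1.contDiffAt.of_le (by norm_cast))
      simp only [Pi.add_apply, Pi.smul_apply]
      rw [this]
      simp
    rw [this]
    exact Ladd _ (hY.2 _ (hZ.2 V hV)) _ (Lsmul _ _ (hZ.2 _ (hY.2 V hV)))
  have Mbr : ∀ Y ∈ L ∩ N, ∀ Z ∈ L ∩ N, VectorField.lieBracket ℝ Y Z ∈ L ∩ N :=
    fun Y hY Z hZ => ⟨hY.2.2 Z hZ.1, Nbr Y hY.2 Z hZ.2⟩
  have MX' : ∀ u, |u| ≤ b → QF β (u • G) ∈ L ∩ N := fun u hu =>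
    ⟨LX u hu, QF_contDiff β _, Lbr u hu⟩
  have Mf : QF β 0 ∈ L ∩ N := by simpa using MX' 0 (by simpa using hb.le)
  have MG : (fun _ => G) ∈ L ∩ N := by
    have e : (fun _ : E => G) = b⁻¹ • (QF β (b • G) + (-1 : ℝ) • QF β 0) := by
      ext1 y
      simp [QF, hb.ne']
    rw [e]
    have h1 := MX' b (by rw [abs_of_pos hb])
    exact ⟨Lsmul _ _ (Ladd _ h1.1 _ (Lsmul _ _ Mf.1)), Nsmul _ _ (Nadd _ h1.2 _ (Nsmul _ _ Mf.2))⟩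
  let W : Submodule ℝ E :=
    { carrier := {v | (fun _ => v) ∈ L ∩ N}
      add_mem' := by
        intro v w hv hw
        exact ⟨Ladd _ hv.1 _ hw.1, Nadd _ hv.2 _ hw.2⟩
      zero_mem' := by
        have := And.intro (Lsmul 0 _ MG.1) (Nsmul 0 _ MG.2)
        have e : (0 : ℝ) • (fun _ : E => G) = fun _ => 0 := by ext1 y; simp
        rw [e] at this
        exact this
      smul_mem' := by
        intro c v hv
        exact ⟨Lsmul c _ hv.1, Nsmul c _ hv.2⟩ }
  have hW : W = ⊤ := by
    apply hG W MG
    intro v hv w hw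
    have e1 : VectorField.lieBracket ℝ (fun _ => v) (QF β 0) = fun y => DQ β y v := by
      ext1 y
      simp [VectorField.lieBracket, QF_fderiv]
    have e2 : VectorField.lieBracket ℝ (fun _ => w) (fun y => DQ β y v) = fun _ => (2 : ℝ) • β v w := by
      ext1 y
      have hd : HasFDerivAt (fun y => DQ β y v) (DQ β v) y := by
        have : (fun y => DQ β y v) = DQ β v := by
          ext1 y; simp [DQ_apply, add_comm]
        rw [this]
        exact (DQ β v).hasFDerivAt
      have e0 : fderiv ℝ (fun _ : E => w) y = 0 := by simp
      rw [VectorField.lieBracket, hd.fderiv, e0, DQ_apply, hsymm w v, two_smul]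
      simp
    have h1 := Mbr _ hv _ Mf
    rw [e1] at h1
    have h2 := Mbr _ hw _ h1
    rw [e2] at h2
    have h3 : (2 : ℝ) • β v w ∈ W := h2
    have := W.smul_mem (2 : ℝ)⁻¹ h3
    simpa [smul_smul] using this
  have hT₀top : T₀ = ⊤ := by
    rw [eq_top_iff]
    intro v _
    have : v ∈ W := by rw [hW]; trivial
    exact this.1.2 z₀ T₀ ⟨hT₀, hr₀⟩
  obtain ⟨F, i1, i2, i3, γ, p, γ', rfl, hd, hr, hran⟩ := hT₀
  have hmap := hd.map_nhds_eq_of_surj (hran.trans hT₀top)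
  refine ⟨γ p, ?_⟩
  rw [mem_interior_iff_mem_nhds, ← hmap]
  exact hr

end PartFour

section PartFive
set_option linter.unusedSectionVars false
open Filter Topology Metric
open scoped NNReal ContDiff

variable {E : Type*} [NormedAddCommGroup E] [NormedSpace ℝ E]

/-- First order expansion, locally uniform. -/
def Ex (P : ℝ → E → E) (X : E → E) : Prop :=
  ∀ R : ℝ, ∃ C δ : ℝ, 0 ≤ C ∧ 0 < δ ∧ ∀ x, ‖x‖ ≤ R → ∀ h, 0 < h → h ≤ δ →
    ‖P h x - x - h • X x‖ ≤ C * h ^ 2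

/-- Lipschitz on balls. -/
def LL (X : E → E) : Prop :=
  ∀ R : ℝ, ∃ L : ℝ, 0 ≤ L ∧ ∀ x y, ‖x‖ ≤ R → ‖y‖ ≤ R → ‖X x - X y‖ ≤ L * ‖x - y‖

lemma LL.add {X Y : E → E} (hX : LL X) (hY : LL Y) : LL (fun x => X x + Y x) := by
  intro R
  obtain ⟨L, hL, h1⟩ := hX R
  obtain ⟨M, hM, h2⟩ := hY R
  refine ⟨L + M, by positivity, fun x y hx hy => ?_⟩
  have e : X x + Y x - (X y + Y y) = (X x - X y) + (Y x - Y y) := by abel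
  rw [e, add_mul]
  exact (norm_add_le _ _).trans (add_le_add (h1 x y hx hy) (h2 x y hx hy))

lemma LL.bdd {X : E → E} (hX : LL X) (R : ℝ) : ∃ M, 0 ≤ M ∧ ∀ x, ‖x‖ ≤ R → ‖X x‖ ≤ M := by
  obtain ⟨L, hL, h⟩ := hX |R|
  refine ⟨L * |R| + ‖X 0‖, by positivity, fun x hx => ?_⟩
  have hx' : ‖x‖ ≤ |R| := hx.trans (le_abs_self R)
  have h1 := h x 0 hx' (by simp)
  have h2 : ‖X x‖ ≤ ‖X x - X 0‖ + ‖X 0‖ := by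
    simpa using norm_add_le (X x - X 0) (X 0)
  rw [sub_zero] at h1
  have h3 : L * ‖x‖ ≤ L * |R| := mul_le_mul_of_nonneg_left hx' hL
  linarith

lemma LL_quad (β : E →L[ℝ] E →L[ℝ] E) (g v : E) (c : ℝ) : LL (fun x => c • QF β g (x + v)) := by
  intro R
  refine ⟨|c| * (2 * ‖β‖ * (|R| + ‖v‖)), by positivity, fun x y hx hy => ?_⟩
  have e : c • QF β g (x + v) - c • QF β g (y + v)
      = c • (β (x + v) (x - y) + β (x - y) (y + v)) := by
    simp only [QF, map_add, map_sub, _root_.add_apply, _root_.sub_apply, ← smul_sub]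
    congr 1
    abel
  rw [e, norm_smul, Real.norm_eq_abs, mul_assoc]
  refine mul_le_mul_of_nonneg_left ?_ (abs_nonneg c)
  have b1 : ‖x + v‖ ≤ |R| + ‖v‖ := (norm_add_le _ _).trans (by gcongr; exact hx.trans (le_abs_self R))
  have b2 : ‖y + v‖ ≤ |R| + ‖v‖ := (norm_add_le _ _).trans (by gcongr; exact hy.trans (le_abs_self R))
  calc ‖β (x + v) (x - y) + β (x - y) (y + v)‖
      ≤ ‖β‖ * ‖x + v‖ * ‖x - y‖ + ‖β‖ * ‖x - y‖ * ‖y + v‖ :=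
        (norm_add_le _ _).trans (add_le_add (β.le_opNorm₂ _ _) (β.le_opNorm₂ _ _))
    _ ≤ ‖β‖ * (|R| + ‖v‖) * ‖x - y‖ + ‖β‖ * ‖x - y‖ * (|R| + ‖v‖) := by gcongr
    _ = _ := by ring

lemma Ex.comp {P Q : ℝ → E → E} {X Y : E → E} (hP : Ex P X) (hQ : Ex Q Y) (hX : LL X) (hY : LL Y) :
    Ex (fun h x => Q h (P h x)) (fun x => X x + Y x) := by
  intro R
  obtain ⟨C₁, δ₁, hC₁, hδ₁, h1⟩ := hP R
  obtain ⟨M, hM, hXM⟩ := hX.bdd R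
  set A := C₁ + M with hA
  obtain ⟨C₂, δ₂, hC₂, hδ₂, h2⟩ := hQ (R + A)
  obtain ⟨L, hL, hYL⟩ := hY (R + A)
  have hA0 : 0 ≤ A := by positivity
  refine ⟨C₁ + C₂ + L * A, min (min δ₁ δ₂) 1, by positivity, by positivity, ?_⟩
  intro x hx h h0 hh
  have hh1 : h ≤ δ₁ := hh.trans ((min_le_left _ _).trans (min_le_left _ _))
  have hh2 : h ≤ δ₂ := hh.trans ((min_le_left _ _).trans (min_le_right _ _))
  have hh3 : h ≤ 1 := hh.trans (min_le_right _ _)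
  have a1 := h1 x hx h h0 hh1
  have a2 : ‖P h x - x‖ ≤ A * h := by
    have e : P h x - x = (P h x - x - h • X x) + h • X x := by abel
    rw [e]
    refine (norm_add_le _ _).trans ?_
    rw [norm_smul, Real.norm_of_nonneg h0.le]
    have := hXM x hx
    have t1 : C₁ * h ^ 2 ≤ C₁ * h := mul_le_mul_of_nonneg_left (by nlinarith) hC₁
    have t2 : h * ‖X x‖ ≤ h * M := mul_le_mul_of_nonneg_left this h0.le
    rw [hA]; linarith
  have a3 : ‖P h x‖ ≤ R + A := by
    have : ‖P h x‖ ≤ ‖P h x - x‖ + ‖x‖ := by simpa using norm_add_le (P h x - x) x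
    have t1 : A * h ≤ A := by nlinarith
    linarith
  have a4 := h2 (P h x) a3 h h0 hh2
  have a5 := hYL (P h x) x a3 (by linarith)
  have e : Q h (P h x) - x - h • (X x + Y x)
      = (Q h (P h x) - P h x - h • Y (P h x)) + (P h x - x - h • X x)
        + h • (Y (P h x) - Y x) := by
    simp only [smul_add, smul_sub]; abel
  rw [e]
  have a6 : ‖h • (Y (P h x) - Y x)‖ ≤ h * (L * (A * h)) := by
    rw [norm_smul, Real.norm_of_nonneg h0.le]
    exact mul_le_mul_of_nonneg_left (a5.trans (mul_le_mul_of_nonneg_left a2 hL)) h0.le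
  calc _ ≤ C₂ * h ^ 2 + C₁ * h ^ 2 + h * (L * (A * h)) :=
        (norm_add_le _ _).trans (add_le_add ((norm_add_le _ _).trans (add_le_add a4 a1)) a6)
    _ = _ := by ring

/-- The Euler method: a closed set invariant under approximate translations is translation invariant. -/
lemma trans_closed {K : Set E} (hK : IsClosed K) {P : ℝ → E → E} {v : E} (hP : Ex P (fun _ => v))
    (hinv : ∀ h, 0 < h → ∀ x ∈ K, P h x ∈ K) {x : E} (hx : x ∈ K) {t : ℝ} (ht : 0 < t) :
    x + t • v ∈ K := by
  obtain ⟨C, δ, hC, hδ, hest⟩ := hP (‖x‖ + t * ‖v‖ + 1)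
  have key : ∀ N : ℕ, 0 < N → t / N ≤ δ → C * t ^ 2 / N ≤ 1 →
      ∃ y ∈ K, ‖y - (x + t • v)‖ ≤ C * t ^ 2 / N := by
    intro N hN h1 h2
    have hN' : (0 : ℝ) < N := by exact_mod_cast hN
    set h := t / N with hh
    have h0 : 0 < h := by positivity
    have hNh : N * h = t := by rw [hh]; field_simp
    have hCN : C * t ^ 2 / N = N * (C * h ^ 2) := by rw [hh]; field_simp
    have ind : ∀ k : ℕ, k ≤ N → ∃ y ∈ K, ‖y - (x + (k * h) • v)‖ ≤ k * (C * h ^ 2) := by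
      intro k
      induction k with
      | zero => intro _; exact ⟨x, hx, by simp⟩
      | succ k ih =>
        intro hk
        obtain ⟨y, hy, hyk⟩ := ih (by omega)
        refine ⟨P h y, hinv h h0 y hy, ?_⟩
        have hkN : (k : ℝ) ≤ N := by exact_mod_cast (by omega : k ≤ N)
        have c1 : (k : ℝ) * (C * h ^ 2) ≤ 1 := by
          refine le_trans ?_ (hCN ▸ h2)
          exact mul_le_mul_of_nonneg_right hkN (by positivity)
        have c2 : ‖y‖ ≤ ‖x‖ + t * ‖v‖ + 1 := by
          have e : y = (y - (x + (k * h) • v)) + x + (k * h) • v := by abel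
          have n1 : ‖y‖ ≤ ‖y - (x + (k * h) • v)‖ + ‖x‖ + ‖((k : ℝ) * h) • v‖ := by
            conv_lhs => rw [e]
            exact norm_add₃_le
          rw [norm_smul, Real.norm_of_nonneg (by positivity : 0 ≤ (k : ℝ) * h)] at n1
          have n2 : (k : ℝ) * h ≤ t := by
            rw [← hNh]; exact mul_le_mul_of_nonneg_right hkN h0.le
          have n3 := mul_le_mul_of_nonneg_right n2 (norm_nonneg v)
          linarith
        have c3 := hest y c2 h h0 h1
        have e : P h y - (x + (((k + 1 : ℕ) : ℝ) * h) • v)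
            = (P h y - y - h • v) + (y - (x + (k * h) • v)) := by
          push_cast
          rw [add_mul, one_mul, add_smul]; abel
        rw [e]
        refine (norm_add_le _ _).trans ?_
        push_cast
        linarith
    obtain ⟨y, hy, h3⟩ := ind N le_rfl
    rw [hNh, ← hCN] at h3
    exact ⟨y, hy, h3⟩
  rw [← hK.closure_eq, Metric.mem_closure_iff]
  intro ε hε
  have T1 : Tendsto (fun N : ℕ => t / (N : ℝ)) atTop (𝓝 0) := tendsto_const_div_atTop_nhds_zero_nat _
  have T2 : Tendsto (fun N : ℕ => C * t ^ 2 / (N : ℝ)) atTop (𝓝 0) :=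
    tendsto_const_div_atTop_nhds_zero_nat _
  obtain ⟨N, e1, e2, e3, e4⟩ := ((eventually_gt_atTop 0).and ((T1.eventually (gt_mem_nhds hδ)).and
    ((T2.eventually (gt_mem_nhds one_pos)).and (T2.eventually (gt_mem_nhds hε))))).exists
  obtain ⟨y, hy, h⟩ := key N e1 e2.le e3.le
  exact ⟨y, hy, by rw [dist_eq_norm, norm_sub_rev]; linarith⟩

variable {β : E →L[ℝ] E →L[ℝ] E} {g : E} {φ : ℝ → E → E}

lemma flow_est (h : IsFlow β g φ) (hA : Apriori β g) (R : ℝ) :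
    ∃ C, 0 ≤ C ∧ ∀ x, ‖x‖ ≤ R → ∀ s, |s| ≤ 1 → ‖φ s x - x - s • QF β g x‖ ≤ C * s ^ 2 := by
  obtain ⟨R', hR', hb⟩ := h.bdd hA R 1
  have hLL : LL (QF β g) := by simpa using LL_quad β g 0 1
  obtain ⟨M, hM, hbM⟩ := hLL.bdd R'
  obtain ⟨L, hL, hl⟩ := hLL R'
  refine ⟨L * M, by positivity, fun x hx s hs => ?_⟩
  have hx' : ‖x‖ ≤ R' := by simpa [h.zero] using hb x hx 0 (by simp)
  have s1 : ∀ τ ∈ Icc (-|s|) |s|, τ ∈ Icc (-1 : ℝ) 1 := fun τ hτ =>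
    ⟨by linarith [hτ.1], by linarith [hτ.2]⟩
  have z0 : (0 : ℝ) ∈ Icc (-|s|) |s| := ⟨by simp, abs_nonneg s⟩
  have zs : s ∈ Icc (-|s|) |s| := ⟨neg_abs_le s, le_abs_self s⟩
  have d1 : ∀ τ ∈ Icc (-|s|) |s|, ‖φ τ x - x‖ ≤ M * |s| := by
    intro τ hτ
    have := (convex_Icc (-|s|) |s|).norm_image_sub_le_of_norm_hasDerivWithin_le
      (f := fun τ => φ τ x) (f' := fun τ => QF β g (φ τ x)) (C := M)
      (fun τ _ => (h.deriv τ x).hasDerivWithinAt) (fun τ hτ => hbM _ (hb x hx τ (s1 τ hτ))) z0 hτ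
    simp only [h.zero, sub_zero, Real.norm_eq_abs] at this
    exact this.trans (mul_le_mul_of_nonneg_left (abs_le.2 hτ) hM)
  have := (convex_Icc (-|s|) |s|).norm_image_sub_le_of_norm_hasDerivWithin_le
      (f := fun τ => φ τ x - τ • QF β g x) (f' := fun τ => QF β g (φ τ x) - QF β g x)
      (C := L * (M * |s|))
      (fun τ _ => by
        have := (h.deriv τ x).sub ((hasDerivAt_id τ).smul_const (QF β g x))
        simpa using! this.hasDerivWithinAt)
      (fun τ hτ => (hl _ _ (hb x hx τ (s1 τ hτ)) hx').trans
        (mul_le_mul_of_nonneg_left (d1 τ hτ) hL)) z0 zs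
  simp only [h.zero, zero_smul, sub_zero, Real.norm_eq_abs] at this
  have e : φ s x - x - s • QF β g x = φ s x - s • QF β g x - x := by abel
  rw [e]
  refine this.trans (le_of_eq ?_)
  rw [← sq_abs s]; ring

lemma flow_Ex (h : IsFlow β g φ) (hA : Apriori β g) (c : ℝ) (v : E) :
    Ex (fun s x => φ (c * s) (x + v) - v) (fun x => c • QF β g (x + v)) := by
  intro R
  obtain ⟨C, hC, hest⟩ := flow_est h hA (R + ‖v‖)
  refine ⟨C * c ^ 2, 1 / (|c| + 1), by positivity, by positivity, fun x hx s h0 hs => ?_⟩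
  have h1 := hest (x + v) ((norm_add_le _ _).trans (by gcongr)) (c * s) (by
    rw [abs_mul, abs_of_pos h0]
    rw [le_div_iff₀ (by positivity)] at hs
    nlinarith [abs_nonneg c])
  have e : φ (c * s) (x + v) - v - x - s • c • QF β g (x + v)
      = φ (c * s) (x + v) - (x + v) - (c * s) • QF β g (x + v) := by
    rw [smul_smul, mul_comm s c]; abel
  rw [e]
  refine h1.trans (le_of_eq (by ring))

lemma flow_reverse (h : IsFlow β g φ) (hA : Apriori β g) (t : ℝ) (x : E) :
    φ t (-x) = -φ (-t) x := by
  have := h.uniq hA (γ := fun t => -φ (-t) x) (fun t => by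
    have h1 := (h.deriv (-t) x).scomp t (hasDerivAt_neg t)
    have h2 := h1.neg
    have e : QF β g (-φ (-t) x) = QF β g (φ (-t) x) := by simp [QF]
    rw [e]
    simpa using! h2) t
  simp only [neg_zero, h.zero] at this
  exact this.symm

end PartFive

section PartFiveB
set_option linter.unusedSectionVars false
open Filter Topology Metric
open scoped NNReal ContDiff

variable {E : Type*} [NormedAddCommGroup E] [InnerProductSpace ℝ E] [FiniteDimensional ℝ E]
  {β : E →L[ℝ] E →L[ℝ] E} {G : E} {b : ℝ} {φ : ℝ → ℝ → E → E} {ψ : ℝ → ℝ → E → E →L[ℝ] E}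

theorem reach_dense (hE : ∀ x, inner ℝ x (β x x) = 0)
    (hT : ∀ x, LinearMap.trace ℝ E (DQ β x) = 0)
    (hφ : ∀ u, SFlow β (u • G) (φ u) (ψ u)) (hb : 0 < b)
    (hsymm : ∀ v w, β v w = β w v)
    (hG : ∀ W : Submodule ℝ E, G ∈ W → (∀ v ∈ W, ∀ w ∈ W, β v w ∈ W) → W = ⊤) (x : E) :
    Dense (interior {y | Rch φ b x y}) := by
  have hne := krener hφ hb hsymm hG x
  set O := interior {y | Rch φ b x y} with hO
  have hOo : IsOpen O := isOpen_interior
  have hc : ∀ u s, Continuous (φ u s) := fun u s =>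
    ((hφ u).toIsFlow.cont (hφ u).apr).comp (by fun_prop : Continuous fun y : E => (s, y))
  have hOf : ∀ u s, |u| ≤ b → 0 ≤ s → ∀ y ∈ O, φ u s y ∈ O := by
    intro u s hu hs y hy
    have hopen : IsOpen ((φ u (-s)) ⁻¹' O) := hOo.preimage (hc u (-s))
    have hsub : (φ u (-s)) ⁻¹' O ⊆ {y | Rch φ b x y} := by
      intro z hz
      have h1 : Rch φ b x (φ u (-s) z) := interior_subset (s := {y | Rch φ b x y}) hz
      have h2 := h1.step hu hs
      rwa [(hφ u).toIsFlow.neg_right (hφ u).apr] at h2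
    refine interior_maximal hsub hopen ?_
    show φ u (-s) (φ u s y) ∈ O
    rwa [(hφ u).toIsFlow.neg_left (hφ u).apr]
  set K := closure O with hKdef
  have hK : IsClosed K := isClosed_closure
  have hKf : ∀ u s, |u| ≤ b → 0 ≤ s → ∀ y ∈ K, φ u s y ∈ K := by
    intro u s hu hs y hy
    exact map_mem_closure (hc u s) hy (fun z hz => hOf u s hu hs z hz)
  have h0b : |(0 : ℝ)| ≤ b := by simpa using hb.le
  have hφ0 : SFlow β 0 (φ 0) (ψ 0) := by simpa using hφ 0
  have hKb : ∀ s, 0 ≤ s → ∀ y ∈ K, φ 0 (-s) y ∈ K := by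
    intro s hs y hy
    have hcl : IsClosed K := hK
    have : φ 0 (-s) y ∈ closure K := by
      refine map_mem_closure (hc 0 (-s)) hy (fun z hz => ?_)
      rw [hKdef, _root_.mem_closure_iff]
      intro V hV hzV
      obtain ⟨w, hw, t, ht, hw'⟩ := flow_recurrent hE hT hφ0 (U := V ∩ (φ 0 s) ⁻¹' O)
        (hV.inter (hOo.preimage (hc 0 s))) ⟨φ 0 (-s) z, hzV, by
          show φ 0 s (φ 0 (-s) z) ∈ O
          rwa [hφ0.toIsFlow.neg_right hφ0.apr]⟩ (s := s + 1) (by linarith)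
      refine ⟨φ 0 t w, hw'.1, ?_⟩
      have e : φ 0 t w = φ 0 (t - s) (φ 0 s w) := by
        rw [← hφ0.toIsFlow.add hφ0.apr]; simp
      rw [e]
      exact hOf 0 (t - s) h0b (by linarith) _ hw.2
    rwa [hcl.closure_eq] at this
  have hK0 : ∀ s, ∀ y ∈ K, φ 0 s y ∈ K := by
    intro s y hy
    rcases le_total 0 s with hs | hs
    · exact hKf 0 s h0b hs y hy
    · simpa using hKb (-s) (by linarith) y hy
  -- translations along the torque
  have hKG : ∀ u, |u| ≤ b → ∀ y ∈ K, ∀ t : ℝ, 0 < t → y + t • (u • G) ∈ K := by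
    intro u hu y hy t ht
    have e1 := flow_Ex hφ0.toIsFlow hφ0.apr (-1) 0
    have e2 := flow_Ex (hφ u).toIsFlow (hφ u).apr 1 0
    have e3 := e1.comp e2 (LL_quad β 0 0 (-1)) (LL_quad β (u • G) 0 1)
    have e4 : (fun x : E => (-1 : ℝ) • QF β 0 (x + 0) + (1 : ℝ) • QF β (u • G) (x + 0))
        = fun _ => u • G := by
      ext1 x; simp [QF]
    rw [e4] at e3
    refine trans_closed hK e3 (fun h h0 z hz => ?_) hy ht
    simp only [add_zero, sub_zero, one_mul]
    exact hKf u h hu h0.le _ (hK0 _ _ hz)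
  let W : Submodule ℝ E :=
    { carrier := {v | ∀ t : ℝ, ∀ y ∈ K, y + t • v ∈ K}
      add_mem' := by
        intro v w hv hw t y hy
        have := hw t _ (hv t y hy)
        rwa [add_assoc, ← smul_add] at this
      zero_mem' := by intro t y hy; simpa using hy
      smul_mem' := by
        intro c v hv t y hy
        rw [smul_smul]
        exact hv _ y hy }
  have hWpos : ∀ v, (∀ t : ℝ, 0 < t → ∀ y ∈ K, y + t • v ∈ K) →
      (∀ t : ℝ, 0 < t → ∀ y ∈ K, y + t • (-v) ∈ K) → v ∈ W := by
    intro v h1 h2 t y hy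
    rcases lt_trichotomy t 0 with ht | ht | ht
    · simpa using h2 (-t) (by linarith) y hy
    · simpa [ht] using hy
    · exact h1 t ht y hy
  have hGW : G ∈ W := by
    have : b • G ∈ W := by
      apply hWpos
      · exact fun t ht y hy => hKG b (by rw [abs_of_pos hb]) y hy t ht
      · intro t ht y hy
        have := hKG (-b) (by rw [abs_neg, abs_of_pos hb]) y hy t ht
        rwa [neg_smul] at this
    have h2 := W.smul_mem b⁻¹ this
    rwa [smul_smul, inv_mul_cancel₀ hb.ne', one_smul] at h2
  have hquad : ∀ v ∈ W, ∀ c : ℝ, ∀ t : ℝ, 0 < t → ∀ y ∈ K, y + t • (c • (2 : ℝ) • β v v) ∈ K := by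
    intro v hv c t ht y hy
    have e1 := flow_Ex hφ0.toIsFlow hφ0.apr c v
    have e2 := flow_Ex hφ0.toIsFlow hφ0.apr c (-v)
    have e3 := flow_Ex hφ0.toIsFlow hφ0.apr (-2 * c) 0
    have e4 := (e1.comp e2 (LL_quad β 0 v c) (LL_quad β 0 (-v) c)).comp e3
      ((LL_quad β 0 v c).add (LL_quad β 0 (-v) c)) (LL_quad β 0 0 (-2 * c))
    have e5 : (fun x : E => c • QF β 0 (x + v) + c • QF β 0 (x + -v) + (-2 * c) • QF β 0 (x + 0))
        = fun _ => c • (2 : ℝ) • β v v := by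
      ext1 x
      simp only [QF, map_add, map_neg, _root_.add_apply, _root_.neg_apply, add_zero]
      module
    rw [e5] at e4
    refine trans_closed hK e4 (fun h h0 z hz => ?_) hy ht
    have hv1 : ∀ z ∈ K, z + v ∈ K := fun z hz => by simpa using hv 1 z hz
    have hv2 : ∀ z ∈ K, z - v ∈ K := fun z hz => by
      simpa [sub_eq_add_neg] using hv (-1) z hz
    simp only [add_zero, sub_zero, sub_neg_eq_add, ← sub_eq_add_neg]
    exact hK0 _ _ (hv1 _ (hK0 _ _ (hv2 _ (hv2 _ (hK0 _ _ (hv1 _ hz))))))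
  have hsq : ∀ v ∈ W, β v v ∈ W := by
    intro v hv
    apply hWpos
    · intro t ht y hy
      have := hquad v hv (1 / 2) t ht y hy
      simpa [smul_smul] using this
    · intro t ht y hy
      have := hquad v hv (-1 / 2) t ht y hy
      rwa [show (-1 / 2 : ℝ) • (2 : ℝ) • β v v = -β v v by module] at this
  have hW : W = ⊤ := by
    apply hG W hGW
    intro v hv w hw
    have h1 := hsq _ (W.add_mem hv hw)
    have h2 := W.sub_mem (W.sub_mem h1 (hsq v hv)) (hsq w hw)
    have e : β (v + w) (v + w) - β v v - β w w = (2 : ℝ) • β v w := by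
      simp only [map_add, _root_.add_apply, hsymm w v]
      module
    rw [e] at h2
    have h3 := W.smul_mem (2 : ℝ)⁻¹ h2
    simpa [smul_smul] using h3
  obtain ⟨o, ho⟩ := hne
  intro y
  have hyo : y - o ∈ W := by rw [hW]; trivial
  have := hyo 1 o (subset_closure ho)
  simpa using this

theorem reach_all (hE : ∀ x, inner ℝ x (β x x) = 0)
    (hT : ∀ x, LinearMap.trace ℝ E (DQ β x) = 0)
    (hφ : ∀ u, SFlow β (u • G) (φ u) (ψ u)) (hb : 0 < b)
    (hsymm : ∀ v w, β v w = β w v)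
    (hG : ∀ W : Submodule ℝ E, G ∈ W → (∀ v ∈ W, ∀ w ∈ W, β v w ∈ W) → W = ⊤) (x y : E) :
    Rch φ b x y := by
  have rev : ∀ p q, Rch φ b p q → Rch φ b (-q) (-p) := by
    intro p q h
    induction h with
    | refl => exact Relation.ReflTransGen.refl
    | tail _ hstep ih =>
      obtain ⟨u, s, hu, hs, rfl⟩ := hstep
      refine Relation.ReflTransGen.head ⟨u, s, hu, hs, ?_⟩ ih
      rw [flow_reverse (hφ u).toIsFlow (hφ u).apr, (hφ u).toIsFlow.neg_left (hφ u).apr]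
  have hd := reach_dense hE hT hφ hb hsymm hG x
  obtain ⟨o, ho⟩ := krener hφ hb hsymm hG (-y)
  have hopen : IsOpen ((fun z : E => -z) ⁻¹' (interior {w | Rch φ b (-y) w})) :=
    isOpen_interior.preimage continuous_neg
  obtain ⟨z, hz1, hz2⟩ := hd.inter_open_nonempty _ hopen ⟨-o, by simpa using ho⟩
  have h1 : Rch φ b x z := interior_subset (s := {y | Rch φ b x y}) hz2
  have h2 : Rch φ b (-y) (-z) := interior_subset (s := {w | Rch φ b (-y) w}) hz1
  have h3 := rev _ _ h2
  simp only [neg_neg] at h3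
  exact Relation.ReflTransGen.trans h1 h3

end PartFiveB

section PartSix
set_option linter.unusedSectionVars false
open Filter Topology

variable {V : Type*} [AddCommGroup V] [Module ℝ V]

/-- `G` generates the nonassociative algebra `(V, B)`. -/
def Gen (B : V →ₗ[ℝ] V →ₗ[ℝ] V) (G : V) : Prop :=
  ∀ W : Submodule ℝ V, G ∈ W → (∀ v ∈ W, ∀ w ∈ W, B v w ∈ W) → W = ⊤

/-- Nonassociative words in one letter. -/
inductive Wd : Type
  | g : Wd
  | m : Wd → Wd → Wd

/-- Evaluation of a word. -/
def Wd.ev (B : V →ₗ[ℝ] V →ₗ[ℝ] V) (G : V) : Wd → V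
  | .g => G
  | .m a b => B (a.ev B G) (b.ev B G)

/-- Linear span of all words. -/
def WS (B : V →ₗ[ℝ] V →ₗ[ℝ] V) (G : V) : Submodule ℝ V := Submodule.span ℝ (range (Wd.ev B G))

lemma WS_mem (B : V →ₗ[ℝ] V →ₗ[ℝ] V) (G : V) : G ∈ WS B G := Submodule.subset_span ⟨Wd.g, rfl⟩

lemma WS_mul (B : V →ₗ[ℝ] V →ₗ[ℝ] V) (G : V) : ∀ v ∈ WS B G, ∀ w ∈ WS B G, B v w ∈ WS B G := by
  intro v hv w hw
  induction hv, hw using Submodule.span_induction₂ with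
  | mem_mem x y hx hy =>
    obtain ⟨a, rfl⟩ := hx
    obtain ⟨c, rfl⟩ := hy
    exact Submodule.subset_span ⟨Wd.m a c, rfl⟩
  | zero_left y hy => simp
  | zero_right x hx => simp
  | add_left x y z _ _ _ h1 h2 => simpa using Submodule.add_mem _ h1 h2
  | add_right x y z _ _ _ h1 h2 => simpa using Submodule.add_mem _ h1 h2
  | smul_left r x y _ _ h => simpa using Submodule.smul_mem _ r h
  | smul_right r x y _ _ h => simpa using Submodule.smul_mem _ r h

lemma ev_mem (B : V →ₗ[ℝ] V →ₗ[ℝ] V) (G : V) (W : Submodule ℝ V) (hG : G ∈ W)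
    (hW : ∀ v ∈ W, ∀ w ∈ W, B v w ∈ W) (a : Wd) : a.ev B G ∈ W := by
  induction a with
  | g => exact hG
  | m a b ha hb => exact hW _ ha _ hb

lemma gen_iff (B : V →ₗ[ℝ] V →ₗ[ℝ] V) (G : V) : Gen B G ↔ WS B G = ⊤ := by
  constructor
  · intro h
    exact h _ (WS_mem B G) (WS_mul B G)
  · intro h W hG hW
    rw [eq_top_iff, ← h, WS, Submodule.span_le]
    rintro _ ⟨a, rfl⟩
    exact ev_mem B G W hG hW a

variable [FiniteDimensional ℝ V]

/-- Determinant of a tuple of words. -/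
noncomputable def WD (B : V →ₗ[ℝ] V →ₗ[ℝ] V) (w : Fin (Module.finrank ℝ V) → Wd) (G : V) : ℝ :=
  (Module.finBasis ℝ V).det (fun i => (w i).ev B G)

lemma top_of_det {W : Submodule ℝ V} (v : Fin (Module.finrank ℝ V) → V) (hv : ∀ i, v i ∈ W)
    (hd : (Module.finBasis ℝ V).det v ≠ 0) : W = ⊤ := by
  have h := ((Module.finBasis ℝ V).is_basis_iff_det (v := v)).2 (isUnit_iff_ne_zero.2 hd)
  rw [eq_top_iff, ← h.2, Submodule.span_le]
  rintro _ ⟨i, rfl⟩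
  exact hv i

lemma gen_of_WD {B : V →ₗ[ℝ] V →ₗ[ℝ] V} {w : Fin (Module.finrank ℝ V) → Wd} {G : V}
    (h : WD B w G ≠ 0) : Gen B G := by
  rw [gen_iff]
  exact top_of_det _ (fun i => Submodule.subset_span ⟨w i, rfl⟩) h

lemma exists_WD {B : V →ₗ[ℝ] V →ₗ[ℝ] V} {G : V} (h : Gen B G) : ∃ w, WD B w G ≠ 0 := by
  rw [gen_iff] at h
  obtain ⟨s, hs, hspan, hli⟩ := exists_linearIndependent ℝ (range (Wd.ev B G))
  have htop : Submodule.span ℝ s = ⊤ := hspan.trans h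
  let b : Module.Basis s ℝ V := Module.Basis.mk hli (by simp [htop])
  have : Fintype s := FiniteDimensional.fintypeBasisIndex b
  have hcard : Fintype.card s = Module.finrank ℝ V := (Module.finrank_eq_card_basis b).symm
  let e : s ≃ Fin (Module.finrank ℝ V) := Fintype.equivFinOfCardEq hcard
  let b' := b.reindex e
  choose w hw using fun i => hs (e.symm i).2
  refine ⟨w, ?_⟩
  have e1 : (fun i => (w i).ev B G) = b' := by
    ext i
    rw [hw i]
    simp [b', b]
  rw [WD, e1]
  exact ((Module.finBasis ℝ V).isUnit_det b').ne_zero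

lemma coord_mul (B : V →ₗ[ℝ] V →ₗ[ℝ] V) (l : V →ₗ[ℝ] ℝ) (x y : V) :
    l (B x y) = ∑ i, ∑ j, (Module.finBasis ℝ V).coord i x * ((Module.finBasis ℝ V).coord j y *
      l (B (Module.finBasis ℝ V i) (Module.finBasis ℝ V j))) := by
  conv_lhs => rw [← (Module.finBasis ℝ V).sum_repr x, ← (Module.finBasis ℝ V).sum_repr y]
  simp only [map_sum, map_smul, LinearMap.sum_apply, LinearMap.smul_apply, smul_eq_mul,
    Module.Basis.coord_apply, Finset.mul_sum]
  rw [Finset.sum_comm]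
  refine Finset.sum_congr rfl fun i _ => Finset.sum_congr rfl fun j _ => ?_
  ring

lemma det_coord (v : Fin (Module.finrank ℝ V) → V) : (Module.finBasis ℝ V).det v =
    ∑ σ : Equiv.Perm (Fin (Module.finrank ℝ V)), ((Equiv.Perm.sign σ : ℤ) : ℝ) *
      ∏ i, (Module.finBasis ℝ V).coord (σ i) (v i) := by
  rw [Module.Basis.det_apply, Matrix.det_apply']
  rfl

lemma ev_continuous {X : Type*} [TopologicalSpace X] (B : V →ₗ[ℝ] V →ₗ[ℝ] V) (c : X → V)
    (hc : ∀ l : V →ₗ[ℝ] ℝ, Continuous fun x => l (c x)) (a : Wd) :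
    ∀ l : V →ₗ[ℝ] ℝ, Continuous fun x => l (a.ev B (c x)) := by
  induction a with
  | g => exact hc
  | m a b ha hb =>
    intro l
    simp only [Wd.ev]
    rw [funext fun x => coord_mul B l (a.ev B (c x)) (b.ev B (c x))]
    have h1 := fun i => ha ((Module.finBasis ℝ V).coord i)
    have h2 := fun i => hb ((Module.finBasis ℝ V).coord i)
    exact continuous_finsetSum _ fun i _ => continuous_finsetSum _ fun j _ =>
      (h1 i).mul ((h2 j).mul continuous_const)

lemma WD_continuous {X : Type*} [TopologicalSpace X] (B : V →ₗ[ℝ] V →ₗ[ℝ] V) (c : X → V)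
    (hc : ∀ l : V →ₗ[ℝ] ℝ, Continuous fun x => l (c x)) (w : Fin (Module.finrank ℝ V) → Wd) :
    Continuous fun x => WD B w (c x) := by
  simp only [WD, det_coord]
  exact continuous_finsetSum _ fun σ _ => continuous_const.mul
    (continuous_finsetProd _ fun i _ => ev_continuous B c hc (w i) _)

lemma ev_analytic (B : V →ₗ[ℝ] V →ₗ[ℝ] V) (c : ℝ → V)
    (hc : ∀ l : V →ₗ[ℝ] ℝ, AnalyticOnNhd ℝ (fun x => l (c x)) univ) (a : Wd) :
    ∀ l : V →ₗ[ℝ] ℝ, AnalyticOnNhd ℝ (fun x => l (a.ev B (c x))) univ := by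
  induction a with
  | g => exact hc
  | m a b ha hb =>
    intro l
    simp only [Wd.ev]
    rw [funext fun x => coord_mul B l (a.ev B (c x)) (b.ev B (c x))]
    have h1 := fun i => ha ((Module.finBasis ℝ V).coord i)
    have h2 := fun i => hb ((Module.finBasis ℝ V).coord i)
    exact Finset.analyticOnNhd_fun_sum _ fun i _ => Finset.analyticOnNhd_fun_sum _ fun j _ =>
      (h1 i).mul ((h2 j).mul analyticOnNhd_const)

lemma WD_analytic (B : V →ₗ[ℝ] V →ₗ[ℝ] V) (c : ℝ → V)
    (hc : ∀ l : V →ₗ[ℝ] ℝ, AnalyticOnNhd ℝ (fun x => l (c x)) univ)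
    (w : Fin (Module.finrank ℝ V) → Wd) :
    AnalyticOnNhd ℝ (fun x => WD B w (c x)) univ := by
  simp only [WD, det_coord]
  exact Finset.analyticOnNhd_fun_sum _ fun σ _ => analyticOnNhd_const.mul
    (Finset.analyticOnNhd_fun_prod _ fun i _ => ev_analytic B c hc (w i) _)

variable [TopologicalSpace V] [IsTopologicalAddGroup V] [ContinuousSMul ℝ V] [T2Space V]

lemma gen_open (B : V →ₗ[ℝ] V →ₗ[ℝ] V) : IsOpen {G | Gen B G} := by
  rw [isOpen_iff_mem_nhds]
  intro G hG
  obtain ⟨w, hw⟩ := exists_WD hG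
  have hc := WD_continuous B (fun x : V => x) (fun l => l.continuous_of_finiteDimensional) w
  filter_upwards [(hc.tendsto G).eventually (isOpen_ne.mem_nhds hw)] with G' h
  exact gen_of_WD h

lemma gen_dense (B : V →ₗ[ℝ] V →ₗ[ℝ] V) {G₁ : V} (h : Gen B G₁) : Dense {G | Gen B G} := by
  obtain ⟨w, hw⟩ := exists_WD h
  intro G₀
  let c : ℝ → V := fun s => G₀ + s • (G₁ - G₀)
  have hcc : Continuous c := by fun_prop
  have hca : ∀ l : V →ₗ[ℝ] ℝ, AnalyticOnNhd ℝ (fun x => l (c x)) univ := by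
    intro l
    simp only [c, map_add, map_smul, smul_eq_mul]
    exact analyticOnNhd_const.add (analyticOnNhd_id.mul analyticOnNhd_const)
  have han := WD_analytic B c hca w
  have h0 : ∀ᶠ s in 𝓝[≠] (0 : ℝ), WD B w (c s) ≠ 0 := by
    rcases (han 0 (mem_univ _)).eventually_eq_zero_or_eventually_ne_zero with h1 | h1
    · exfalso
      have := han.eqOn_zero_of_preconnected_of_eventuallyEq_zero isPreconnected_univ (mem_univ 0) h1
        (mem_univ 1)
      apply hw
      simpa [c] using this
    · exact h1
  rw [_root_.mem_closure_iff_frequently]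
  have ht : Tendsto c (𝓝[≠] 0) (𝓝 G₀) := by
    have := (hcc.tendsto 0).mono_left (nhdsWithin_le_nhds (s := {0}ᶜ))
    simpa [c] using this
  exact ht.frequently (h0.mono fun s hs => gen_of_WD hs).frequently

end PartSix

section PartSixB
set_option linter.unusedSectionVars false
open Filter Topology
variable {V : Type*} [AddCommGroup V] [Module ℝ V] [FiniteDimensional ℝ V]

/-- Deformation argument for the existence of one generator. -/
lemma exists_gen (B : V →ₗ[ℝ] V →ₗ[ℝ] V) (hsymm : ∀ x y, B x y = B y x) (P H : V) (hP : B P P = 0)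
    (hgen : ∀ W : Submodule ℝ V, P ∈ W → B P H ∈ W → (∀ v ∈ W, ∀ w ∈ W, B v w ∈ W) → W = ⊤) :
    ∃ G, Gen B G := by
  let Gε : ℝ → V := fun ε => P + ε • H
  let S : Submodule ℝ V :=
    { carrier := {x | ∃ v : ℝ → V, v 0 = x ∧ (∀ l : V →ₗ[ℝ] ℝ, Continuous fun ε => l (v ε)) ∧
        ∀ ε, ε ≠ 0 → v ε ∈ WS B (Gε ε)}
      add_mem' := by
        rintro x y ⟨v, hv0, hv1, hv2⟩ ⟨w, hw0, hw1, hw2⟩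
        refine ⟨fun ε => v ε + w ε, by simp [hv0, hw0], fun l => ?_, fun ε hε =>
          Submodule.add_mem _ (hv2 ε hε) (hw2 ε hε)⟩
        simp only [map_add]
        exact (hv1 l).add (hw1 l)
      zero_mem' := ⟨fun _ => 0, rfl, fun l => continuous_const, fun ε _ => Submodule.zero_mem _⟩
      smul_mem' := by
        rintro c x ⟨v, hv0, hv1, hv2⟩
        refine ⟨fun ε => c • v ε, by simp [hv0], fun l => ?_, fun ε hε =>
          Submodule.smul_mem _ c (hv2 ε hε)⟩
        simp only [map_smul, smul_eq_mul]
        exact continuous_const.mul (hv1 l) }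
  have hS : S = ⊤ := by
    apply hgen
    · refine ⟨Gε, by simp [Gε], fun l => ?_, fun ε _ => WS_mem _ _⟩
      simp only [Gε, map_add, map_smul]
      fun_prop
    · have : (2 : ℝ) • B P H ∈ S := by
        refine ⟨fun ε => (2 : ℝ) • B P H + ε • B H H, by simp, fun l => ?_, fun ε hε => ?_⟩
        · simp only [map_add, map_smul]
          fun_prop
        · have h1 := WS_mul B (Gε ε) _ (WS_mem _ _) _ (WS_mem _ _)
          have h2 := Submodule.smul_mem _ ε⁻¹ h1
          convert h2 using 1
          simp only [Gε, map_add, map_smul, LinearMap.add_apply, LinearMap.smul_apply, hP, hsymm H P]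
          rw [← sub_eq_zero]
          match_scalars <;> field_simp <;> ring
      have h2 := S.smul_mem (2 : ℝ)⁻¹ this
      simpa [smul_smul] using h2
    · rintro x ⟨v, hv0, hv1, hv2⟩ y ⟨w, hw0, hw1, hw2⟩
      refine ⟨fun ε => B (v ε) (w ε), by simp [hv0, hw0], fun l => ?_, fun ε hε =>
        WS_mul _ _ _ (hv2 ε hε) _ (hw2 ε hε)⟩
      rw [funext fun ε => coord_mul B l (v ε) (w ε)]
      exact continuous_finsetSum _ fun i _ => continuous_finsetSum _ fun j _ =>
        (hv1 _).mul ((hw1 _).mul continuous_const)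
  have hb : ∀ i, Module.finBasis ℝ V i ∈ S := fun i => by rw [hS]; trivial
  choose v hv0 hv1 hv2 using hb
  have hdc : Continuous fun ε => (Module.finBasis ℝ V).det (fun i => v i ε) := by
    simp only [det_coord]
    exact continuous_finsetSum _ fun σ _ => continuous_const.mul
      (continuous_finsetProd _ fun i _ => hv1 i _)
  have h0 : (Module.finBasis ℝ V).det (fun i => v i 0) ≠ 0 := by
    simp only [hv0]
    rw [Module.Basis.det_self]
    exact one_ne_zero
  have hev := ((hdc.tendsto 0).mono_left (nhdsWithin_le_nhds (s := {0}ᶜ))).eventually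
    (isOpen_ne.mem_nhds h0)
  obtain ⟨ε, h1, h2⟩ := (hev.and self_mem_nhdsWithin).exists
  refine ⟨Gε ε, (gen_iff _ _).2 (top_of_det (fun i => v i ε) (fun i => hv2 i ε h2) h1)⟩

/-- Separation of eigenvectors in an invariant subspace. -/
lemma eig_sep {ι : Type*} [DecidableEq ι] (L : V →ₗ[ℝ] V) (W : Submodule ℝ V)
    (hW : ∀ v ∈ W, L v ∈ W) (lam : ι → ℝ) (s : Finset ι) : ∀ (x : ι → V),
    (∀ i ∈ s, L (x i) = lam i • x i) → (∀ i ∈ s, ∀ j ∈ s, lam i = lam j → i = j) →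
    ∑ i ∈ s, x i ∈ W → ∀ i ∈ s, x i ∈ W := by
  induction s using Finset.induction_on with
  | empty => simp
  | insert j s hj ih =>
    intro x hx hinj hsum
    rw [Finset.sum_insert hj] at hsum
    have h1 := W.sub_mem (hW _ hsum) (W.smul_mem (lam j) hsum)
    have e : L (x j + ∑ i ∈ s, x i) - lam j • (x j + ∑ i ∈ s, x i)
        = ∑ i ∈ s, (lam i - lam j) • x i := by
      rw [map_add, map_sum, hx j (Finset.mem_insert_self _ _), smul_add, add_sub_add_left_eq_sub,
        Finset.smul_sum, ← Finset.sum_sub_distrib]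
      refine Finset.sum_congr rfl fun i hi => ?_
      rw [hx i (Finset.mem_insert_of_mem hi), sub_smul]
    rw [e] at h1
    have h2 := ih (fun i => (lam i - lam j) • x i)
      (fun i hi => by
        rw [map_smul, hx i (Finset.mem_insert_of_mem hi), smul_comm])
      (fun i hi k hk => hinj i (Finset.mem_insert_of_mem hi) k (Finset.mem_insert_of_mem hk)) h1
    have h3 : ∀ i ∈ s, x i ∈ W := by
      intro i hi
      have hne : lam i - lam j ≠ 0 := by
        intro h0
        have := hinj i (Finset.mem_insert_of_mem hi) j (Finset.mem_insert_self _ _) (sub_eq_zero.1 h0)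
        exact hj (this ▸ hi)
      have := W.smul_mem (lam i - lam j)⁻¹ (h2 i hi)
      rwa [smul_smul, inv_mul_cancel₀ hne, one_smul] at this
    intro i hi
    rcases Finset.mem_insert.1 hi with rfl | hi
    · have := W.sub_mem hsum (W.sum_mem h3)
      simpa using this
    · exact h3 i hi

end PartSixB

section PartSeven
open Filter Topology

theorem abstract_control {V : Type*} [AddCommGroup V] [Module ℝ V] [FiniteDimensional ℝ V]
    (B : V →ₗ[ℝ] V →ₗ[ℝ] V) (hsymm : ∀ x y, B x y = B y x) (core : InnerProductSpace.Core ℝ V)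
    (hE : ∀ x, core.inner x (B x x) = 0) (hT : ∀ x, LinearMap.trace ℝ V (B x) = 0)
    (G : V) (hG : Gen B G) :
    ∃ φ : ℝ → ℝ → V → V, (∀ u x, φ u 0 x = x) ∧
      (∀ u s x (l : V →ₗ[ℝ] ℝ),
        HasDerivAt (fun τ => l (φ u τ x)) (l (B (φ u s x) (φ u s x) + u • G)) s) ∧
      ∀ b, 0 < b → ∀ x y,
        Relation.ReflTransGen (fun x y => ∃ u s : ℝ, |u| ≤ b ∧ 0 ≤ s ∧ y = φ u s x) x y := by
  let _ : NormedAddCommGroup V := core.toNormedAddCommGroup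
  let _ : InnerProductSpace ℝ V := InnerProductSpace.ofCore core.toCore
  let β : V →L[ℝ] V →L[ℝ] V := LinearMap.toContinuousLinearMap
    ((LinearMap.toContinuousLinearMap : (V →ₗ[ℝ] V) ≃ₗ[ℝ] (V →L[ℝ] V)).toLinearMap ∘ₗ B)
  have hβ : ∀ x y, β x y = B x y := fun x y => rfl
  have hE' : ∀ x, inner ℝ x (β x x) = 0 := fun x => hE x
  have hT' : ∀ x, LinearMap.trace ℝ V (DQ β x) = 0 := by
    intro x
    have : ((DQ β x : V →L[ℝ] V) : V →ₗ[ℝ] V) = (2 : ℝ) • B x := by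
      ext y
      simp only [ContinuousLinearMap.coe_coe, DQ_apply, hβ, hsymm y x, two_smul]
      rfl
    rw [this, map_smul, hT, smul_zero]
  choose φ ψ hφ using fun u : ℝ => exists_sflow (apriori_of_energy hE' (u • G))
  refine ⟨φ, fun u x => (hφ u).zero x, fun u s x l => ?_, fun b hb x y => ?_⟩
  · have := (LinearMap.toContinuousLinearMap l).hasFDerivAt.comp_hasDerivAt s ((hφ u).deriv s x)
    exact this
  · exact reach_all hE' hT' hφ hb (fun v w => hsymm v w) hG x y

end PartSeven

section PartEight

/-- The space of skew-symmetric matrices. -/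
def Sk (n : ℕ) : Submodule ℝ (Matrix (Fin n) (Fin n) ℝ) where
  carrier := {X | Xᵀ = -X}
  add_mem' := by
    intro X Y hX hY
    simp only [mem_ofPred_eq] at *
    rw [transpose_add, hX, hY, neg_add]
  zero_mem' := by simp
  smul_mem' := by
    intro c X hX
    simp only [mem_ofPred_eq] at *
    rw [transpose_smul, hX, smul_neg]

variable {n : ℕ}

lemma Sk.apply (X : Sk n) (i j : Fin n) : X.1 i j = -X.1 j i := by
  have := congrFun (congrFun X.2 j) i
  simpa using this

lemma Sk.diag (X : Sk n) (i : Fin n) : X.1 i i = 0 := by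
  have := Sk.apply X i i
  linarith

/-- Structure coefficients. -/
noncomputable def gam (d : Fin n → ℝ) (i k : Fin n) : ℝ := (d i - d k) / (d i + d k)

lemma gam_neg (d : Fin n → ℝ) (i k : Fin n) : gam d k i = -gam d i k := by
  rw [gam, gam, ← neg_div, neg_sub, add_comm]

/-- The quadratic operator of the rigid body, in the eigenbasis. -/
noncomputable def BM (d : Fin n → ℝ) (X Y : Matrix (Fin n) (Fin n) ℝ) : Matrix (Fin n) (Fin n) ℝ :=
  Matrix.of fun i k => (1 / 2) * gam d i k * (X * Y + Y * X) i k

lemma BM_mem (d : Fin n → ℝ) (X Y : Sk n) : BM d X.1 Y.1 ∈ Sk n := by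
  show (BM d X.1 Y.1)ᵀ = -BM d X.1 Y.1
  ext i k
  simp only [transpose_apply, BM, of_apply, Matrix.neg_apply]
  have h : (X.1 * Y.1 + Y.1 * X.1) k i = (X.1 * Y.1 + Y.1 * X.1) i k := by
    have : (X.1 * Y.1 + Y.1 * X.1)ᵀ = X.1 * Y.1 + Y.1 * X.1 := by
      rw [transpose_add, transpose_mul, transpose_mul, X.2, Y.2]
      simp [add_comm]
    exact congrFun (congrFun this i) k
  rw [h, gam_neg d i k]
  ring

/-- Bilinear version. -/
noncomputable def BS (d : Fin n → ℝ) : Sk n →ₗ[ℝ] Sk n →ₗ[ℝ] Sk n :=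
  LinearMap.mk₂ ℝ (fun X Y => ⟨BM d X.1 Y.1, BM_mem d X Y⟩)
    (by
      intro X X' Y
      ext i k
      simp only [Submodule.coe_add, BM, of_apply, Matrix.add_apply, Matrix.add_mul, Matrix.mul_add]
      ring)
    (by
      intro c X Y
      ext i k
      simp only [Submodule.coe_smul, BM, of_apply, Matrix.add_apply, Matrix.smul_mul,
        Matrix.mul_smul, Matrix.smul_apply, smul_eq_mul]
      ring)
    (by
      intro X X' Y
      ext i k
      simp only [Submodule.coe_add, BM, of_apply, Matrix.add_apply, Matrix.add_mul, Matrix.mul_add]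
      ring)
    (by
      intro c X Y
      ext i k
      simp only [Submodule.coe_smul, BM, of_apply, Matrix.add_apply, Matrix.smul_mul,
        Matrix.mul_smul, Matrix.smul_apply, smul_eq_mul]
      ring)

lemma BS_coe (d : Fin n → ℝ) (X Y : Sk n) : (BS d X Y).1 = BM d X.1 Y.1 := rfl

lemma BS_symm (d : Fin n → ℝ) (X Y : Sk n) : BS d X Y = BS d Y X := by
  ext i k
  simp only [BS_coe, BM, of_apply, add_comm]

/-- Kinetic energy inner product. -/
noncomputable def EC (d : Fin n → ℝ) (hd : ∀ i, 0 < d i) : InnerProductSpace.Core ℝ (Sk n) where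
  inner X Y := ∑ i, ∑ j, (d i + d j) * (X.1 i j * Y.1 i j)
  conj_inner_symm X Y := by simp [mul_comm]
  re_inner_nonneg X := by
    simp only [RCLike.re_to_real]
    exact Finset.sum_nonneg fun i _ => Finset.sum_nonneg fun j _ =>
      mul_nonneg (add_pos (hd i) (hd j)).le (mul_self_nonneg _)
  add_left X Y Z := by
    simp only [Submodule.coe_add, Matrix.add_apply, add_mul, mul_add, Finset.sum_add_distrib]
  smul_left X Y r := by
    simp only [Submodule.coe_smul, Matrix.smul_apply, smul_eq_mul, conj_trivial, Finset.mul_sum]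
    refine Finset.sum_congr rfl fun i _ => Finset.sum_congr rfl fun j _ => ?_
    ring
  definite X h := by
    have h0 : ∀ i j, 0 ≤ (d i + d j) * (X.1 i j * X.1 i j) := fun i j =>
      mul_nonneg (add_pos (hd i) (hd j)).le (mul_self_nonneg _)
    ext i j
    have h1 := (Finset.sum_eq_zero_iff_of_nonneg
      (fun i _ => Finset.sum_nonneg fun j _ => h0 i j)).1 h i (Finset.mem_univ _)
    have h2 := (Finset.sum_eq_zero_iff_of_nonneg (fun j _ => h0 i j)).1 h1 j (Finset.mem_univ _)
    rcases mul_eq_zero.1 h2 with h3 | h3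
    · exact absurd h3 (add_pos (hd i) (hd j)).ne'
    · simpa using h3

lemma EC_energy (d : Fin n → ℝ) (hd : ∀ i, 0 < d i) (X : Sk n) :
    (EC d hd).inner X (BS d X X) = 0 := by
  show ∑ i, ∑ k, (d i + d k) * (X.1 i k * (BS d X X).1 i k) = 0
  have e : ∀ i k, (d i + d k) * (X.1 i k * (BS d X X).1 i k)
      = ∑ j, (d i * (X.1 i k * (X.1 i j * X.1 j k))) - ∑ j, (d k * (X.1 i k * (X.1 i j * X.1 j k))) := by
    intro i k
    have hne : d i + d k ≠ 0 := (add_pos (hd i) (hd k)).ne'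
    simp only [BS_coe, BM, of_apply, gam, Matrix.add_apply, Matrix.mul_apply]
    simp only [← Finset.mul_sum]
    field_simp
    ring
  simp only [e, Finset.sum_sub_distrib]
  have h1 : ∑ i, ∑ k, ∑ j, d i * (X.1 i k * (X.1 i j * X.1 j k)) = 0 := by
    apply Finset.sum_eq_zero
    intro i _
    have : ∑ k, ∑ j, d i * (X.1 i k * (X.1 i j * X.1 j k))
        = -∑ k, ∑ j, d i * (X.1 i k * (X.1 i j * X.1 j k)) := by
      conv_lhs => rw [Finset.sum_comm]
      simp only [← Finset.sum_neg_distrib]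
      refine Finset.sum_congr rfl fun k _ => Finset.sum_congr rfl fun j _ => ?_
      rw [Sk.apply X j k]; ring
    linarith
  have h2 : ∑ i, ∑ k, ∑ j, d k * (X.1 i k * (X.1 i j * X.1 j k)) = 0 := by
    rw [Finset.sum_comm]
    apply Finset.sum_eq_zero
    intro k _
    have : ∑ i, ∑ j, d k * (X.1 i k * (X.1 i j * X.1 j k))
        = -∑ i, ∑ j, d k * (X.1 i k * (X.1 i j * X.1 j k)) := by
      conv_lhs => rw [Finset.sum_comm]
      simp only [← Finset.sum_neg_distrib]
      refine Finset.sum_congr rfl fun i _ => Finset.sum_congr rfl fun j _ => ?_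
      rw [Sk.apply X j i]; ring
    linarith
  rw [h1, h2, sub_zero]

/-- Sign vector flipping one index. -/
def sg (a i : Fin n) : ℝ := if i = a then -1 else 1

lemma sg_sq (a i : Fin n) : sg a i * sg a i = 1 := by
  unfold sg; split_ifs <;> norm_num

/-- Conjugation by a sign matrix. -/
def cj (a : Fin n) : Sk n →ₗ[ℝ] Sk n where
  toFun X := ⟨Matrix.of fun i j => sg a i * X.1 i j * sg a j, by
    show (Matrix.of _)ᵀ = -Matrix.of _
    ext i j
    simp only [transpose_apply, of_apply, Matrix.neg_apply]
    rw [Sk.apply X j i]; ring⟩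
  map_add' X Y := by
    ext i j
    simp only [Submodule.coe_add, of_apply, Matrix.add_apply]
    ring
  map_smul' c X := by
    ext i j
    simp only [Submodule.coe_smul, of_apply, Matrix.smul_apply, smul_eq_mul, RingHom.id_apply]
    ring

lemma cj_coe (a : Fin n) (X : Sk n) (i j : Fin n) : (cj a X).1 i j = sg a i * X.1 i j * sg a j := rfl

lemma cj_cj (a : Fin n) (X : Sk n) : cj a (cj a X) = X := by
  ext i j
  rw [cj_coe, cj_coe]
  have h1 := sg_sq a i
  have h2 := sg_sq a j
  calc sg a i * (sg a i * X.1 i j * sg a j) * sg a j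
      = (sg a i * sg a i) * X.1 i j * (sg a j * sg a j) := by ring
    _ = X.1 i j := by rw [h1, h2]; ring

/-- Conjugation by a sign matrix, as an equivalence. -/
def cjE (a : Fin n) : Sk n ≃ₗ[ℝ] Sk n :=
  LinearEquiv.ofInvolutive (cj a) (cj_cj a)

lemma cj_BS (d : Fin n → ℝ) (a : Fin n) (X Y : Sk n) : BS d (cj a X) (cj a Y) = cj a (BS d X Y) := by
  have key : ∀ X Y : Sk n, ∀ i k, ((cj a X).1 * (cj a Y).1) i k = sg a i * (X.1 * Y.1) i k * sg a k := by
    intro X Y i k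
    simp only [Matrix.mul_apply, cj_coe, Finset.mul_sum, Finset.sum_mul]
    refine Finset.sum_congr rfl fun j _ => ?_
    have h1 := sg_sq a j
    calc sg a i * X.1 i j * sg a j * (sg a j * Y.1 j k * sg a k)
        = sg a i * X.1 i j * (sg a j * sg a j) * (Y.1 j k * sg a k) := by ring
      _ = _ := by rw [h1]; ring
  ext i k
  rw [cj_coe]
  simp only [BS_coe, BM, of_apply, Matrix.add_apply, key]
  ring

lemma BS_trace (d : Fin n → ℝ) (X : Sk n) : LinearMap.trace ℝ (Sk n) (BS d X) = 0 := by
  have h1 : ∀ a, LinearMap.trace ℝ (Sk n) (BS d (cj a X)) = LinearMap.trace ℝ (Sk n) (BS d X) := by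
    intro a
    have : BS d (cj a X) = (cjE a).conj (BS d X) := by
      apply LinearMap.ext
      intro Y
      rw [LinearEquiv.conj_apply_apply]
      show _ = cj a (BS d X (cj a Y))
      rw [← cj_BS, cj_cj]
    rw [this, LinearMap.trace_conj']
  have h2 : ∑ a, (X - cj a X) = (4 : ℝ) • X := by
    ext i j
    simp only [AddSubmonoidClass.coe_finsetSum, Matrix.sum_apply, Submodule.coe_sub,
      Matrix.sub_apply, Submodule.coe_smul, Matrix.smul_apply, smul_eq_mul, cj_coe]
    rcases eq_or_ne i j with rfl | hij
    · simp [Sk.diag X]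
    · have : ∀ a, X.1 i j - sg a i * X.1 i j * sg a j
          = (if i = a then 2 * X.1 i j else 0) + (if j = a then 2 * X.1 i j else 0) := by
        intro a
        unfold sg
        by_cases h1 : i = a <;> by_cases h2 : j = a
        · exact absurd (h1.trans h2.symm) hij
        all_goals simp [h1, h2]; try ring
      simp only [this, Finset.sum_add_distrib, Finset.sum_ite_eq, Finset.mem_univ, if_true]
      ring
  have h3 : LinearMap.trace ℝ (Sk n) (BS d ((4 : ℝ) • X)) = 0 := by
    rw [← h2, map_sum, map_sum]
    apply Finset.sum_eq_zero
    intro a _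
    rw [map_sub, map_sub, h1, sub_self]
  rw [map_smul, map_smul, smul_eq_mul] at h3
  linarith

end PartEight

section PartNine

variable {n : ℕ}

/-- Elementary skew matrices. -/
def Esk (a b : Fin n) : Sk n :=
  ⟨Matrix.single a b 1 - Matrix.single b a 1, by
    show (_ : Matrix (Fin n) (Fin n) ℝ)ᵀ = -_
    rw [transpose_sub, transpose_single, transpose_single, neg_sub]⟩

lemma Esk_coe (a b : Fin n) : (Esk a b).1 = Matrix.single a b 1 - Matrix.single b a 1 := rfl

lemma Esk_neg (a b : Fin n) : Esk b a = -Esk a b := by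
  ext i j
  simp [Esk_coe]

lemma BS_Esk (d : Fin n → ℝ) {a b c : Fin n} (hab : a ≠ b) (hbc : b ≠ c) (hac : a ≠ c) :
    BS d (Esk a b) (Esk b c) = ((1 / 2) * gam d a c) • Esk a c := by
  have h : (Esk a b).1 * (Esk b c).1 + (Esk b c).1 * (Esk a b).1
      = Matrix.single a c 1 + Matrix.single c a 1 := by
    simp only [Esk_coe, Matrix.sub_mul, Matrix.mul_sub]
    simp [hab, hbc, hac, hab.symm, hbc.symm, hac.symm, Matrix.single_mul_single_of_ne]
  ext i k
  rw [BS_coe, BM, of_apply, h, Submodule.coe_smul, Matrix.smul_apply, Esk_coe, smul_eq_mul,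
    Matrix.add_apply, Matrix.sub_apply]
  simp only [Matrix.single_apply]
  by_cases h1 : a = i ∧ c = k
  · obtain ⟨rfl, rfl⟩ := h1
    simp [hac, hac.symm]
  · by_cases h2 : c = i ∧ a = k
    · obtain ⟨rfl, rfl⟩ := h2
      simp [hac, hac.symm, gam_neg d a c]
    · simp [h1, h2]

lemma BS_Esk_self (d : Fin n → ℝ) {a b : Fin n} (hab : a ≠ b) :
    BS d (Esk a b) (Esk a b) = 0 := by
  ext i k
  rw [BS_coe, BM, of_apply]
  have h : (Esk a b).1 * (Esk a b).1 = - Matrix.single a a 1 - Matrix.single b b 1 := by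
    simp only [Esk_coe, Matrix.sub_mul, Matrix.mul_sub]
    simp [hab, hab.symm, Matrix.single_mul_single_of_ne]
    abel
  rw [h]
  by_cases hik : i = k
  · subst hik
    simp [gam]
  · have h1 : ∀ a : Fin n, Matrix.single a a (1 : ℝ) i k = 0 := by
      intro a
      rw [Matrix.single_apply, if_neg]
      rintro ⟨rfl, rfl⟩
      exact hik rfl
    simp [h1]

lemma Esk_span (W : Submodule ℝ (Sk n)) (h : ∀ a b, a ≠ b → Esk a b ∈ W) : W = ⊤ := by
  rw [eq_top_iff]
  intro X _
  have h2 : (2 : ℝ) • X = ∑ a, ∑ b, X.1 a b • Esk a b := by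
    ext i j
    simp only [AddSubmonoidClass.coe_finsetSum, Matrix.sum_apply, Submodule.coe_smul,
      Matrix.smul_apply, smul_eq_mul, Esk_coe, Matrix.sub_apply, Matrix.single_apply, mul_sub,
      Finset.sum_sub_distrib, mul_ite, mul_one, mul_zero, ite_and]
    simp only [Finset.sum_ite_eq', Finset.mem_univ, if_true,
      Finset.sum_ite_irrel, Finset.sum_const_zero]
    rw [Sk.apply X j i]
    ring
  have h3 : (2 : ℝ) • X ∈ W := by
    rw [h2]
    refine Submodule.sum_mem _ fun a _ => Submodule.sum_mem _ fun b _ => ?_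
    rcases eq_or_ne a b with rfl | hab
    · rw [Sk.diag X, zero_smul]; exact W.zero_mem
    · exact W.smul_mem _ (h a b hab)
  have := W.smul_mem (1 / 2 : ℝ) h3
  rwa [smul_smul, show (1 / 2 : ℝ) * 2 = 1 by norm_num, one_smul] at this

lemma frac_lt {c x y : ℝ} (hc : 0 < c) (hx : 0 < x) (hxy : x < y) :
    (c - y) / (c + y) < (c - x) / (c + x) := by
  rw [div_lt_div_iff₀ (by linarith) (by linarith)]
  nlinarith

lemma exists_generator (hn : 3 ≤ n) (d : Fin n → ℝ) (hd : ∀ i, 0 < d i)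
    (hinj : Function.Injective d) : ∃ G, Gen (BS d) G := by
  classical
  obtain ⟨p, -, hp⟩ := Finset.exists_max_image (Finset.univ : Finset (Fin n)) d
    ⟨⟨0, by omega⟩, Finset.mem_univ _⟩
  have hne : ((Finset.univ : Finset (Fin n)).erase p).Nonempty := by
    rw [← Finset.card_pos, Finset.card_erase_of_mem (Finset.mem_univ _), Finset.card_univ,
      Fintype.card_fin]
    omega
  obtain ⟨q, hq0, hq⟩ := Finset.exists_max_image _ d hne
  have hqp : q ≠ p := Finset.ne_of_mem_erase hq0
  set s : Finset (Fin n) := (Finset.univ.erase p).erase q with hs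
  have hsm : ∀ k, k ∈ s ↔ k ≠ q ∧ k ≠ p := by intro k; simp [hs]
  have hdq : ∀ k ∈ s, d k < d q := by
    intro k hk
    have hk' := (hsm k).1 hk
    exact lt_of_le_of_ne (hq k (by simp [hk'.2])) (fun h => hk'.1 (hinj h))
  have hdp : ∀ k ∈ s, d k < d p := fun k hk => lt_of_lt_of_le (hdq k hk) (hp q (Finset.mem_univ _))
  have gq : ∀ k ∈ s, 0 < gam d q k := fun k hk =>
    div_pos (sub_pos.2 (hdq k hk)) (add_pos (hd _) (hd _))
  have gp : ∀ k ∈ s, 0 < gam d p k := fun k hk =>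
    div_pos (sub_pos.2 (hdp k hk)) (add_pos (hd _) (hd _))
  have gne : ∀ k l, k ≠ l → gam d k l ≠ 0 := fun k l h =>
    div_ne_zero (sub_ne_zero.2 (fun h' => h (hinj h'))) (add_pos (hd _) (hd _)).ne'
  have e1 : ∀ k ∈ s, BS d (Esk p q) (Esk q k) = ((1 / 2) * gam d p k) • Esk p k := fun k hk =>
    BS_Esk d hqp.symm ((hsm k).1 hk).1.symm ((hsm k).1 hk).2.symm
  have e2 : ∀ k ∈ s, BS d (Esk p q) (Esk p k) = (-((1 / 2) * gam d q k)) • Esk q k := by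
    intro k hk
    rw [Esk_neg q p, map_neg, LinearMap.neg_apply,
      BS_Esk d hqp ((hsm k).1 hk).2.symm ((hsm k).1 hk).1.symm]
    exact (neg_smul _ _).symm
  apply exists_gen (BS d) (BS_symm d) (Esk p q) (∑ k ∈ s, Esk q k) (BS_Esk_self d hqp.symm)
  intro W hP hPH hW
  have hsum : ∑ k ∈ s, ((1 / 2) * gam d p k) • Esk p k ∈ W := by
    rw [map_sum, Finset.sum_congr rfl e1] at hPH
    exact hPH
  have hsep := eig_sep ((BS d (Esk p q)) ∘ₗ (BS d (Esk p q))) W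
    (fun v hv => hW _ hP _ (hW _ hP _ hv))
    (fun k => -((1 / 2) * gam d q k) * ((1 / 2) * gam d p k)) s
    (fun k => ((1 / 2) * gam d p k) • Esk p k)
    (by
      intro k hk
      rw [map_smul, LinearMap.comp_apply, e2 k hk, map_smul, e1 k hk, smul_smul (-_), smul_comm])
    (by
      have key : ∀ i ∈ s, ∀ j ∈ s, d i < d j →
          gam d q j * gam d p j < gam d q i * gam d p i := fun i hi j hj h =>
        mul_lt_mul'' (frac_lt (hd q) (hd i) h) (frac_lt (hd p) (hd i) h) (gq j hj).le (gp j hj).le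
      intro i hi j hj h
      rcases lt_trichotomy (d i) (d j) with h1 | h1 | h1
      · have := key i hi j hj h1
        linarith
      · exact hinj h1
      · have := key j hj i hi h1
        linarith)
    hsum
  have mp : ∀ k ∈ s, Esk p k ∈ W := by
    intro k hk
    have h1 := hsep k hk
    exact (W.smul_mem_iff (by have := gp k hk; positivity)).1 h1
  have mq : ∀ k ∈ s, Esk q k ∈ W := by
    intro k hk
    have h1 := hW _ hP _ (mp k hk)
    rw [e2 k hk] at h1
    exact (W.smul_mem_iff (neg_ne_zero.2 (by have := gq k hk; positivity))).1 h1
  have sym : ∀ a b, Esk a b ∈ W → Esk b a ∈ W := by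
    intro a b h
    rw [Esk_neg a b]
    exact W.neg_mem h
  have mp' : ∀ k, k ≠ p → Esk p k ∈ W := by
    intro k hk
    by_cases hkq : k = q
    · rw [hkq]; exact hP
    · exact mp k ((hsm k).2 ⟨hkq, hk⟩)
  apply Esk_span
  intro a b hab
  by_cases ha : a = p
  · subst ha; exact mp' b hab.symm
  by_cases hb : b = p
  · subst hb; exact sym _ _ (mp' a ha)
  have h1 := hW _ (sym _ _ (mp' a ha)) _ (mp' b hb)
  rw [BS_Esk d ha (Ne.symm hb) hab] at h1
  exact (W.smul_mem_iff (mul_ne_zero (by norm_num) (gne a b hab))).1 h1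

end PartNine

section PartTen

variable {n m : ℕ}

lemma sb_refl (C : Mat n) (ν : ℝ) (G : Fin m → Mat n) {b : ℝ} (hb : 0 ≤ b) {X : Mat n}
    (hX : IsSkew X) : SteersBounded C ν G b X X := by
  refine ⟨0, fun _ _ => 0, fun _ => X, 0, fun _ => 0, le_rfl, rfl, rfl, ?_, continuousOn_const,
    fun _ _ => hX, rfl, rfl, ?_, ?_, ?_⟩
  · intro i hi; omega
  · intro j s _; simpa using hb
  · intro i hi; omega
  · intro i hi; omega

lemma sb_step (C : Mat n) (ν : ℝ) (G : Fin m → Mat n) {b : ℝ} {X Y : Mat n}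
    (h : SteersBounded C ν G b X Y) (s : ℝ) (hs : 0 < s) (v : Fin m → ℝ) (hv : ∀ j, |v j| ≤ b)
    (c : ℝ → Mat n) (hc : Continuous c) (hsk : ∀ τ, IsSkew (c τ)) (hc0 : c 0 = Y)
    (hD : ∀ τ, ∃ D : Mat n, (∀ p q : Fin n, HasDerivAt (fun τ => c τ p q) (D p q) τ) ∧
      IC C D = mbracket C ((c τ) ^ 2) - ν • IC C (c τ) + ∑ j, v j • IC C (G j)) :
    SteersBounded C ν G b X (c s) := by
  obtain ⟨T, u, Ω, k, t, hT, ht0, htk, htm, hΩ, hΩs, hΩ0, hΩT, hu, huc, hDΩ⟩ := h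
  have hle : ∀ j, j ≤ k → t j ≤ T := by
    intro j hj
    rw [← htk]
    induction hj using Nat.decreasingInduction with
    | self => exact le_rfl
    | of_succ i hi ih => exact (htm i hi).le.trans ih
  have hc' : ∀ τ, T ≤ τ → (if τ ≤ T then Ω τ else c (τ - T)) = c (τ - T) := by
    intro τ hτ
    rcases hτ.eq_or_lt with rfl | h
    · rw [if_pos le_rfl, hΩT, sub_self, hc0]
    · rw [if_neg (not_le.2 h)]
  refine ⟨T + s, fun j τ => if τ ≤ T then u j τ else v j,
    fun τ => if τ ≤ T then Ω τ else c (τ - T), k + 1, fun i => if i ≤ k then t i else T + s,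
    by linarith, by simp [ht0], by simp, ?_, ?_, ?_, ?_, ?_, ?_, ?_, ?_⟩
  · intro i hi
    rcases Nat.lt_succ_iff_lt_or_eq.1 hi with h | rfl
    · simp only [h.le, Nat.succ_le_of_lt h, if_true]
      exact htm i h
    · simp [htk, hs]
  · have : Icc 0 (T + s) = Icc 0 T ∪ Icc T (T + s) := (Icc_union_Icc_eq_Icc hT (by linarith)).symm
    rw [this]
    refine ContinuousOn.union_of_isClosed ?_ ?_ isClosed_Icc isClosed_Icc
    · exact hΩ.congr fun τ hτ => if_pos hτ.2
    · refine ContinuousOn.congr (f := fun τ => c (τ - T)) ?_ fun τ hτ => hc' τ hτ.1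
      exact (hc.comp (continuous_id.sub continuous_const)).continuousOn
  · intro τ hτ
    by_cases h : τ ≤ T
    · simp only [h, if_true]; exact hΩs τ ⟨hτ.1, h⟩
    · simp only [h, if_false]; exact hsk _
  · simp [hT, hΩ0]
  · exact (hc' (T + s) (by linarith)).trans (by rw [add_sub_cancel_left])
  · intro j τ hτ
    by_cases h : τ ≤ T
    · simp only [h, if_true]; exact hu j τ ⟨hτ.1, h⟩
    · simp only [h, if_false]; exact hv _
  · intro i hi j
    rcases Nat.lt_succ_iff_lt_or_eq.1 hi with h | rfl
    · simp only [h.le, Nat.succ_le_of_lt h, if_true]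
      obtain ⟨a, ha⟩ := huc i h j
      refine ⟨a, fun τ hτ => ?_⟩
      rw [if_pos (hτ.2.le.trans (hle _ h))]
      exact ha τ hτ
    · refine ⟨v j, fun τ hτ => ?_⟩
      simp only [le_refl, if_true, htk] at hτ
      exact if_neg (not_le.2 hτ.1)
  · intro i hi τ hτ
    rcases Nat.lt_succ_iff_lt_or_eq.1 hi with h | rfl
    · simp only [h.le, Nat.succ_le_of_lt h, if_true] at hτ
      obtain ⟨D, hD1, hD2⟩ := hDΩ i h τ hτ
      have hτT : τ < T := hτ.2.trans_le (hle _ h)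
      refine ⟨D, fun p q => ?_, ?_⟩
      · refine (hD1 p q).congr_of_eventuallyEq ?_
        filter_upwards [Iio_mem_nhds hτT] with σ hσ
        rw [if_pos (le_of_lt hσ)]
      · simp only [hτT.le, if_true]
        exact hD2
    · simp only [le_refl, if_true, htk] at hτ
      obtain ⟨D, hD1, hD2⟩ := hD (τ - T)
      refine ⟨D, fun p q => ?_, ?_⟩
      · have h1 : HasDerivAt (fun σ => c (σ - T) p q) (D p q) τ := (hD1 p q).comp_sub_const τ T
        refine h1.congr_of_eventuallyEq ?_
        filter_upwards [Ioi_mem_nhds hτ.1] with σ hσ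
        rw [if_neg (not_le.2 hσ)]
      · simp only [not_le.2 hτ.1, if_false]
        exact hD2

lemma sb_steers (C : Mat n) (ν : ℝ) (G : Fin m → Mat n) {b : ℝ} {X Y : Mat n}
    (h : SteersBounded C ν G b X Y) : Steers C ν G X Y := by
  obtain ⟨T, u, Ω, k, t, h1, h2, h3, h4, h5, h6, h7, h8, h9, h10, h11⟩ := h
  exact ⟨T, u, Ω, k, t, h1, h2, h3, h4, h5, h6, h7, h8, h10, h11⟩

lemma IC_diag (d : Fin n → ℝ) (hd : ∀ i, 0 < d i) (X : Mat n) :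
    IC (Matrix.diagonal d) (BM d X X) = mbracket (Matrix.diagonal d) (X ^ 2) := by
  ext i k
  have hne : d i + d k ≠ 0 := (add_pos (hd i) (hd k)).ne'
  rw [IC, mbracket, pow_two, Matrix.add_apply, Matrix.sub_apply, Matrix.mul_diagonal,
    Matrix.diagonal_mul, Matrix.mul_diagonal, Matrix.diagonal_mul, BM, of_apply, Matrix.add_apply,
    gam]
  field_simp
  ring

/-- Conjugation by an orthogonal matrix. -/
def cU (U X : Mat n) : Mat n := U * X * Uᵀ

lemma cU_mul {U : Mat n} (hU : Uᵀ * U = 1) (X Y : Mat n) : cU U X * cU U Y = cU U (X * Y) := by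
  unfold cU
  calc U * X * Uᵀ * (U * Y * Uᵀ) = U * X * (Uᵀ * U) * (Y * Uᵀ) := by simp only [Matrix.mul_assoc]
    _ = _ := by rw [hU, Matrix.mul_one]; simp only [Matrix.mul_assoc]

lemma cU_add (U X Y : Mat n) : cU U (X + Y) = cU U X + cU U Y := by
  unfold cU; rw [Matrix.mul_add, Matrix.add_mul]

lemma cU_sub (U X Y : Mat n) : cU U (X - Y) = cU U X - cU U Y := by
  unfold cU; rw [Matrix.mul_sub, Matrix.sub_mul]

lemma cU_smul (U X : Mat n) (c : ℝ) : cU U (c • X) = c • cU U X := by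
  unfold cU; rw [Matrix.mul_smul, Matrix.smul_mul]

lemma cU_skew (U : Mat n) {X : Mat n} (hX : Xᵀ = -X) : (cU U X)ᵀ = -cU U X := by
  unfold cU
  rw [transpose_mul, transpose_mul, transpose_transpose, hX]
  simp [Matrix.mul_assoc]

lemma cU_inv {U : Mat n} (hU : Uᵀ * U = 1) (X : Mat n) : cU Uᵀ (cU U X) = X := by
  unfold cU
  rw [transpose_transpose]
  calc Uᵀ * (U * X * Uᵀ) * U = (Uᵀ * U) * X * (Uᵀ * U) := by simp only [Matrix.mul_assoc]
    _ = X := by rw [hU]; simp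

lemma cU_cont (U : Mat n) : Continuous (cU U) := by
  unfold cU; fun_prop

lemma IC_cU {U : Mat n} (hU : Uᵀ * U = 1) (A X : Mat n) : IC (cU U A) (cU U X) = cU U (IC A X) := by
  unfold IC; rw [cU_mul hU, cU_mul hU, cU_add]

lemma mbracket_cU {U : Mat n} (hU : Uᵀ * U = 1) (A X : Mat n) :
    mbracket (cU U A) (cU U X) = cU U (mbracket A X) := by
  unfold mbracket; rw [cU_mul hU, cU_mul hU, cU_sub]

lemma IC_add_smul (A X Y : Mat n) (c : ℝ) : IC A (X + c • Y) = IC A X + c • IC A Y := by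
  unfold IC
  rw [Matrix.mul_add, Matrix.add_mul, Matrix.mul_smul, Matrix.smul_mul, smul_add]
  abel

lemma euler_cU {U : Mat n} (hU : Uᵀ * U = 1) (d : Fin n → ℝ) (hd : ∀ i, 0 < d i) (X G : Mat n)
    (c : ℝ) : IC (cU U (Matrix.diagonal d)) (cU U (BM d X X + c • G))
      = mbracket (cU U (Matrix.diagonal d)) ((cU U X) ^ 2)
        + c • IC (cU U (Matrix.diagonal d)) (cU U G) := by
  rw [pow_two, cU_mul hU, mbracket_cU hU, IC_cU hU, IC_cU hU, IC_add_smul, IC_diag d hd, cU_add,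
    cU_smul, pow_two]

/-- Coordinates of the conjugated matrix, as linear functionals. -/
def cUl (U : Mat n) (p q : Fin n) : Sk n →ₗ[ℝ] ℝ where
  toFun X := cU U X.1 p q
  map_add' X Y := by rw [Submodule.coe_add, cU_add, Matrix.add_apply]
  map_smul' c X := by rw [Submodule.coe_smul, cU_smul, Matrix.smul_apply]; rfl

lemma cUl_apply (U : Mat n) (p q : Fin n) (X : Sk n) : cUl U p q X = cU U X.1 p q := rfl

/-- The homeomorphism given by orthogonal conjugation. -/
def cUH {U : Mat n} (hU : Uᵀ * U = 1) (hU' : U * Uᵀ = 1) : {G : Mat n // IsSkew G} ≃ₜ Sk n where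
  toFun G := ⟨cU Uᵀ G.1, cU_skew _ G.2⟩
  invFun X := ⟨cU U X.1, cU_skew _ X.2⟩
  left_inv G := by
    apply Subtype.ext
    have := cU_inv (U := Uᵀ) (by rwa [transpose_transpose]) G.1
    rwa [transpose_transpose] at this
  right_inv X := Subtype.ext (cU_inv hU X.1)
  continuous_toFun := ((cU_cont _).comp continuous_subtype_val).subtype_mk _
  continuous_invFun := ((cU_cont _).comp continuous_subtype_val).subtype_mk _

lemma steer_main {U : Mat n} (hU : Uᵀ * U = 1) (hU' : U * Uᵀ = 1) (d : Fin n → ℝ)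
    (hd : ∀ i, 0 < d i) (G : {G : Mat n // IsSkew G}) (hG : Gen (BS d) (cUH hU hU' G))
    (b : ℝ) (hb : 0 < b) (X Y : {G : Mat n // IsSkew G}) :
    SteersBounded (cU U (Matrix.diagonal d)) 0 ![G.1] b X.1 Y.1 := by
  obtain ⟨φ, h0, hder, hreach⟩ := abstract_control (BS d) (BS_symm d) (EC d hd) (EC_energy d hd)
    (BS_trace d) (cUH hU hU' G) hG
  have inv : ∀ Z : {G : Mat n // IsSkew G}, cU U (cUH hU hU' Z).1 = Z.1 := fun Z =>
    congrArg Subtype.val ((cUH hU hU').symm_apply_apply Z)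
  have key : ∀ y, Relation.ReflTransGen (fun x y => ∃ u s : ℝ, |u| ≤ b ∧ 0 ≤ s ∧ y = φ u s x)
      (cUH hU hU' X) y → SteersBounded (cU U (Matrix.diagonal d)) 0 ![G.1] b X.1 (cU U y.1) := by
    intro y hy
    induction hy with
    | refl => rw [inv]; exact sb_refl _ _ _ hb.le X.2
    | tail _ hst ih =>
      rename_i y z _
      obtain ⟨u, s, hu, hs, rfl⟩ := hst
      rcases hs.eq_or_lt with rfl | hs
      · rw [h0]; exact ih
      have hd1 : ∀ τ p q, HasDerivAt (fun τ => cU U (φ u τ y).1 p q)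
          (cU U (BM d (φ u τ y).1 (φ u τ y).1 + u • (cUH hU hU' G).1) p q) τ := fun τ p q =>
        hder u τ y (cUl U p q)
      refine sb_step _ _ _ ih s hs (fun _ => u) (fun _ => hu) (fun τ => cU U (φ u τ y).1) ?_ ?_ ?_ ?_
      · refine continuous_matrix fun p q => ?_
        exact continuous_iff_continuousAt.2 fun τ => (hd1 τ p q).continuousAt
      · intro τ; exact cU_skew _ (φ u τ y).2
      · simp only [h0]
      · intro τ
        refine ⟨_, hd1 τ, ?_⟩
        rw [euler_cU hU d hd, inv]
        simp
  have := key _ (hreach b hb (cUH hU hU' X) (cUH hU hU' Y))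
  rwa [inv] at this

end PartTen

/-- **Theorem 2 (global controllability of the non-damped MRB by a single generic torque).**
For `n ≥ 3` and symmetric positive definite `C` with distinct eigenvalues, there is an open
dense subset `𝒢` of `so(n)` such that for every `G ∈ 𝒢` the single-torque non-damped system
`I_C(Ω̇) = [C, Ω²] + u(t) I_C(G)` is globally controllable, and is still globally controllable
under any control bound `|u| ≤ b`, `b > 0`. -/
theorem mrb_global_controllability_one_torque_generic
    (n : ℕ) (hn : 3 ≤ n) (C : Mat n) (hC : C.PosDef)
    (hdist : Function.Injective hC.1.eigenvalues) :
    ∃ 𝒢 : Set {G : Mat n // IsSkew G}, IsOpen 𝒢 ∧ Dense 𝒢 ∧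
      ∀ G ∈ 𝒢,
        (∀ Ω₀ Ω₁ : Mat n, IsSkew Ω₀ → IsSkew Ω₁ →
          Steers C 0 ![(G : {G : Mat n // IsSkew G}).1] Ω₀ Ω₁) ∧
        (∀ b : ℝ, 0 < b → ∀ Ω₀ Ω₁ : Mat n, IsSkew Ω₀ → IsSkew Ω₁ →
          SteersBounded C 0 ![(G : {G : Mat n // IsSkew G}).1] b Ω₀ Ω₁) := by
  have hd : ∀ i, 0 < hC.1.eigenvalues i := hC.eigenvalues_pos
  have hspec := hC.1.spectral_theorem
  have hUm := hC.1.eigenvectorUnitary.2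
  set d := hC.1.eigenvalues with hdd
  obtain ⟨U, hUU⟩ : ∃ U : Mat n, U = (hC.1.eigenvectorUnitary : Mat n) := ⟨_, rfl⟩
  have hU : Uᵀ * U = 1 := by
    rw [hUU]; exact (Unitary.mem_iff.1 hUm).1
  have hU' : U * Uᵀ = 1 := by
    rw [hUU]; exact (Unitary.mem_iff.1 hUm).2
  have hCU : C = cU U (Matrix.diagonal d) := by
    rw [hUU]; exact hspec
  obtain ⟨G₁, hG₁⟩ := exists_generator hn d hd hdist
  have main : ∀ G ∈ (cUH hU hU') ⁻¹' {G | Gen (BS d) G}, ∀ b : ℝ, 0 < b → ∀ Ω₀ Ω₁ : Mat n,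
      IsSkew Ω₀ → IsSkew Ω₁ → SteersBounded C 0 ![G.1] b Ω₀ Ω₁ := by
    intro G hG b hb Ω₀ Ω₁ h₀ h₁
    have := steer_main hU hU' d hd G hG b hb ⟨Ω₀, h₀⟩ ⟨Ω₁, h₁⟩
    rwa [← hCU] at this
  refine ⟨(cUH hU hU') ⁻¹' {G | Gen (BS d) G}, (gen_open (BS d)).preimage (cUH hU hU').continuous,
    (gen_dense (BS d) hG₁).preimage (cUH hU hU').isOpenMap, fun G hG => ⟨?_, main G hG⟩⟩
  intro Ω₀ Ω₁ h₀ h₁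
  exact sb_steers _ _ _ (main G hG 1 one_pos Ω₀ Ω₁ h₀ h₁)
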